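/- Let G be a finite simple graph with no isolated vertex satisfying reg(R/I(G)) ≥ 2, let {x_i,x_j} be an edge of G, and let S be an independent set of G such that no vertex of S is adjacent to x_i or to x_j, and such that every vertex of G not in S ∪ {x_i,x_j} is adjacent to some vertex of S ∪ {x_i,x_j}. Then reg(R'/I(G^{{x_i,x_j},S})) = reg(R/I(G)). -/

import Mathlib

open MvPolynomial PowerSeries

/-- A matching of a simple graph: a set of pairwise disjoint edges. -/
def IsMatchingSet {V : Type*} (G : SimpleGraph V) (M : Finset (Sym2 V)) : Prop :=
  (↑M : Set (Sym2 V)) ⊆ G.edgeSet ∧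
    ∀ e ∈ M, ∀ f ∈ M, e ≠ f → ∀ v, v ∈ e → v ∉ f

/-- An induced matching: a matching such that no edge of `G` meets two distinct
edges of the matching. -/
def IsInducedMatchingSet {V : Type*} (G : SimpleGraph V) (M : Finset (Sym2 V)) : Prop :=
  IsMatchingSet G M ∧
    ∀ e ∈ G.edgeSet, ∀ f ∈ M, ∀ g ∈ M, f ≠ g →
      ¬((∃ v, v ∈ e ∧ v ∈ f) ∧ (∃ w, w ∈ e ∧ w ∈ g))

/-- The matching number `m(G)`. -/
noncomputable def matchNum {V : Type*} (G : SimpleGraph V) : ℕ :=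
  sSup {k | ∃ M : Finset (Sym2 V), IsMatchingSet G M ∧ M.card = k}

/-- The induced matching number `im(G)`. -/
noncomputable def indMatchNum {V : Type*} (G : SimpleGraph V) : ℕ :=
  sSup {k | ∃ M : Finset (Sym2 V), IsInducedMatchingSet G M ∧ M.card = k}

/-- The `S`-suspension `G^S`: add a new vertex (`none`) joined to every vertex not in `S`. -/
def sSusp {V : Type*} (G : SimpleGraph V) (S : Set V) : SimpleGraph (Option V) :=
  SimpleGraph.fromRel (fun a b =>
    (∃ x y, a = some x ∧ b = some y ∧ G.Adj x y) ∨
    (a = none ∧ ∃ y, b = some y ∧ y ∉ S))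

/-- The `{x_i,x_j}, S`-suspension: add a new vertex (`none`) joined to every vertex
outside `S ∪ {i, j}`. -/
def eSusp {V : Type*} (G : SimpleGraph V) (i j : V) (S : Set V) : SimpleGraph (Option V) :=
  SimpleGraph.fromRel (fun a b =>
    (∃ x y, a = some x ∧ b = some y ∧ G.Adj x y) ∨
    (a = none ∧ ∃ y, b = some y ∧ y ∉ S ∧ y ≠ i ∧ y ≠ j))

/-- The edge ideal of a graph. -/
noncomputable def edgeIdeal (K : Type*) [Field K] {σ : Type*} (G : SimpleGraph σ) :
    Ideal (MvPolynomial σ K) :=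
  Ideal.span {p | ∃ i j, G.Adj i j ∧ p = X i * X j}

/-- The Hilbert function of `R/I` (standard grading). -/
noncomputable def hilbFun (K : Type*) [Field K] {σ : Type*}
    (I : Ideal (MvPolynomial σ K)) (n : ℕ) : ℕ :=
  Module.finrank K ((homogeneousSubmodule σ K n).map
    (Ideal.Quotient.mkₐ K I).toLinearMap)

/-- The Hilbert series of `R/I`, as a power series over `ℚ`. -/
noncomputable def hilbSeries (K : Type*) [Field K] {σ : Type*}
    (I : Ideal (MvPolynomial σ K)) : PowerSeries ℚ :=
  PowerSeries.mk fun n => (hilbFun K I n : ℚ)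

/-- `HilbEq K I d h` says that the Hilbert series of `R/I` equals `h(λ)/(1-λ)^d`
with `h(1) ≠ 0`, i.e. `h` is the `h`-polynomial and `d = dim R/I`. -/
def HilbEq (K : Type*) [Field K] {σ : Type*} (I : Ideal (MvPolynomial σ K))
    (d : ℕ) (h : Polynomial ℤ) : Prop :=
  hilbSeries K I * (1 - PowerSeries.X) ^ d =
    ((h.map (Int.castRingHom ℚ) : Polynomial ℚ) : PowerSeries ℚ) ∧ h.eval 1 ≠ 0

/-- `regBound K I r` : there is a finite graded free resolution of `R/I` all of whose
generator degrees in homological degree `i` are at most `i + r`.  The minimal free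
resolution realizes `r = reg(R/I)`, and the generator degrees of any graded free
resolution contain those of the minimal one, hence
`reg(R/I) = sInf {r | regBound K I r}`. -/
noncomputable def regBound (K : Type*) [Field K] {σ : Type*}
    (I : Ideal (MvPolynomial σ K)) (r : ℕ) : Prop :=
  ∃ (L : ℕ) (k : ℕ → ℕ) (d : (i : ℕ) → Fin (k i) → ℕ)
    (φ : (i : ℕ) → ((Fin (k (i + 1)) →₀ MvPolynomial σ K) →ₗ[MvPolynomial σ K]
      (Fin (k i) →₀ MvPolynomial σ K)))
    (ε : (Fin (k 0) →₀ MvPolynomial σ K) →ₗ[MvPolynomial σ K] (MvPolynomial σ K ⧸ I)),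
    (∀ i, L ≤ i → k i = 0) ∧
    (∀ (i : ℕ) (b : Fin (k (i + 1))) (a : Fin (k i)),
      (φ i (Finsupp.single b 1)) a ∈ homogeneousSubmodule σ K (d (i + 1) b - d i a) ∧
      (d (i + 1) b < d i a → (φ i (Finsupp.single b 1)) a = 0)) ∧
    (∀ a : Fin (k 0), ε (Finsupp.single a 1) ∈
      (homogeneousSubmodule σ K (d 0 a)).map (Ideal.Quotient.mkₐ K I).toLinearMap) ∧
    Function.Surjective ε ∧
    LinearMap.range (φ 0) = LinearMap.ker ε ∧
    (∀ i : ℕ, LinearMap.range (φ (i + 1)) = LinearMap.ker (φ i)) ∧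
    (∀ (i : ℕ) (a : Fin (k i)), d i a ≤ i + r)

/-- The Castelnuovo–Mumford regularity of `R/I`. -/
noncomputable def reg (K : Type*) [Field K] {σ : Type*}
    (I : Ideal (MvPolynomial σ K)) : ℕ :=
  sInf {r | regBound K I r}

set_option linter.unusedSectionVars false

section GradedRB

universe u w

/-- graded module structure -/
structure GM {K : Type w} [CommRing K] {A : Type u} [CommRing A] [Algebra K A]
    (𝒜 : ℕ → Submodule K A) (M : Type u) [AddCommGroup M] [Module A M] where
  gr : ℕ → AddSubgroup M
  smul_mem : ∀ m n a x, a ∈ 𝒜 m → x ∈ gr n → a • x ∈ gr (m + n)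

variable {K : Type w} [CommRing K] {A : Type u} [CommRing A] [Algebra K A]
    {𝒜 : ℕ → Submodule K A} [SetLike.GradedMonoid 𝒜]

variable {M : Type u} [AddCommGroup M] [Module A M]
variable {N : Type u} [AddCommGroup N] [Module A N]
variable {P : Type u} [AddCommGroup P] [Module A P]

/-- graded pieces, with the whole module as piece `none` -/
def GM.g (𝓜 : GM 𝒜 M) : Option ℕ → AddSubgroup M
  | none => ⊤
  | some n => 𝓜.gr n

def GM.comap (f : N →ₗ[A] M) (𝓜 : GM 𝒜 M) : GM 𝒜 N where
  gr n := (𝓜.gr n).comap f.toAddMonoidHom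
  smul_mem m n a x ha hx := by
    have := 𝓜.smul_mem m n a (f x) ha hx
    simpa using this

theorem GM.mem_comap (f : N →ₗ[A] M) (𝓜 : GM 𝒜 M) (o : Option ℕ) (x : N) :
    x ∈ (𝓜.comap f).g o ↔ f x ∈ 𝓜.g o := by
  cases o with
  | none => simp [GM.g]
  | some n => rfl

def GM.map (f : N →ₗ[A] M) (𝓝 : GM 𝒜 N) : GM 𝒜 M where
  gr n := (𝓝.gr n).map f.toAddMonoidHom
  smul_mem m n a x ha hx := by
    obtain ⟨y, hy, rfl⟩ := hx
    exact ⟨a • y, 𝓝.smul_mem m n a y ha hy, by simp⟩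

def GM.shift (𝓜 : GM 𝒜 M) : GM 𝒜 M where
  gr n := Nat.casesOn n ⊥ 𝓜.gr
  smul_mem m n a x ha hx := by
    cases n with
    | zero =>
      have : x = 0 := hx
      subst this
      rw [smul_zero]; exact zero_mem _
    | succ n => exact 𝓜.smul_mem m n a x ha hx

theorem GM.shift_zero (𝓜 : GM 𝒜 M) (x : M) : x ∈ 𝓜.shift.gr 0 ↔ x = 0 := Iff.rfl

def freeGr (𝒜 : ℕ → Submodule K A) [SetLike.GradedMonoid 𝒜] {ι : Type} (d : ι → ℕ) :
    GM 𝒜 (ι → A) where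
  gr n :=
    { carrier := {f | ∀ a, f a ∈ 𝒜 (n - d a) ∧ (n < d a → f a = 0)}
      zero_mem' := fun a => ⟨zero_mem _, fun _ => rfl⟩
      add_mem' := fun {x y} hx hy a => ⟨add_mem (hx a).1 (hy a).1, fun h => by
        simp [(hx a).2 h, (hy a).2 h]⟩
      neg_mem' := fun {x} hx a => ⟨neg_mem (hx a).1, fun h => by simp [(hx a).2 h]⟩ }
  smul_mem m n c x hc hx := by
    intro a
    rcases lt_or_ge n (d a) with h | h
    · have : (c • x) a = 0 := by simp [(hx a).2 h]
      rw [this]; exact ⟨zero_mem _, fun _ => rfl⟩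
    · refine ⟨?_, fun h' => absurd h' (by omega)⟩
      have : m + n - d a = m + (n - d a) := by omega
      rw [this]
      exact SetLike.mul_mem_graded hc (hx a).1

theorem mem_freeGr {ι : Type} (d : ι → ℕ) (n : ℕ) (f : ι → A) :
    f ∈ (freeGr 𝒜 d).gr n ↔ ∀ a, f a ∈ 𝒜 (n - d a) ∧ (n < d a → f a = 0) := Iff.rfl

theorem single_mem_freeGr {ι : Type} [DecidableEq ι] (d : ι → ℕ) (a : ι) :
    (Pi.single a 1 : ι → A) ∈ (freeGr 𝒜 d).gr (d a) := by
  intro b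
  by_cases h : b = a
  · subst h
    simp only [Pi.single_eq_same, le_refl, tsub_eq_zero_of_le, lt_irrefl, false_imp_iff, and_true]
    exact SetLike.one_mem_graded 𝒜
  · rw [Pi.single_eq_of_ne h]; exact ⟨zero_mem _, fun _ => rfl⟩

def GH (f : M →ₗ[A] N) (𝓜 : GM 𝒜 M) (𝓝 : GM 𝒜 N) : Prop :=
  ∀ o, ∀ x ∈ 𝓜.g o, f x ∈ 𝓝.g o

def GS (f : M →ₗ[A] N) (𝓜 : GM 𝒜 M) (𝓝 : GM 𝒜 N) : Prop :=
  ∀ o, ∀ y ∈ 𝓝.g o, ∃ x ∈ 𝓜.g o, f x = y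

theorem GH.mk {f : M →ₗ[A] N} {𝓜 : GM 𝒜 M} {𝓝 : GM 𝒜 N}
    (h : ∀ n, ∀ x ∈ 𝓜.gr n, f x ∈ 𝓝.gr n) : GH f 𝓜 𝓝 := by
  intro o x hx
  cases o with
  | none => trivial
  | some n => exact h n x hx

theorem GS.surj {f : M →ₗ[A] N} {𝓜 : GM 𝒜 M} {𝓝 : GM 𝒜 N} (h : GS f 𝓜 𝓝) :
    Function.Surjective f := fun y => by
  obtain ⟨x, -, hx⟩ := h none y trivial
  exact ⟨x, hx⟩

theorem GH.shift {f : M →ₗ[A] N} {𝓜 : GM 𝒜 M} {𝓝 : GM 𝒜 N} (h : GH f 𝓜 𝓝) :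
    GH f 𝓜.shift 𝓝.shift := by
  refine GH.mk fun n x hx => ?_
  cases n with
  | zero => have : x = 0 := hx
            subst this; rw [map_zero]; exact zero_mem _
  | succ n => exact h (some n) x hx

theorem GS.shift {f : M →ₗ[A] N} {𝓜 : GM 𝒜 M} {𝓝 : GM 𝒜 N} (h : GS f 𝓜 𝓝) :
    GS f 𝓜.shift 𝓝.shift := by
  intro o y hy
  rcases o with - | - | n
  · exact h none y hy
  · have : y = 0 := hy
    exact ⟨0, zero_mem _, by simp [this]⟩
  · exact h (some n) y hy

theorem GH_lincomb {ι : Type} [Fintype ι] (d : ι → ℕ) (y : ι → M) (𝓜 : GM 𝒜 M)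
    (hy : ∀ a, y a ∈ 𝓜.gr (d a)) : GH (Fintype.linearCombination A y) (freeGr 𝒜 d) 𝓜 := by
  refine GH.mk fun n x hx => ?_
  rw [Fintype.linearCombination_apply]
  refine sum_mem fun a _ => ?_
  rcases lt_or_ge n (d a) with h | h
  · rw [(hx a).2 h, zero_smul]; exact zero_mem _
  · have := 𝓜.smul_mem _ _ _ _ (hx a).1 (hy a)
    rwa [Nat.sub_add_cancel h] at this

/-- resolution of length `L` with generator degrees bounded by `i + r` -/
def RB (𝒜 : ℕ → Submodule K A) [SetLike.GradedMonoid 𝒜] :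
    ℕ → ∀ (M : Type u) [AddCommGroup M] [Module A M], GM 𝒜 M → ℕ → Prop
  | 0, M, _, _, _, _ => Subsingleton M
  | L + 1, M, _, _, 𝓜, r => ∃ (ι : Type) (_ : Fintype ι) (d : ι → ℕ) (e : (ι → A) →ₗ[A] M),
      (∀ a, d a ≤ r) ∧ GH e (freeGr 𝒜 d) 𝓜 ∧ GS e (freeGr 𝒜 d) 𝓜 ∧
      RB 𝒜 L (LinearMap.ker e) ((freeGr 𝒜 d).comap (LinearMap.ker e).subtype) (r + 1)

theorem RB_of_subsingleton : ∀ (L : ℕ) (M : Type u) [AddCommGroup M] [Module A M]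
    (𝓜 : GM 𝒜 M) (r : ℕ), Subsingleton M → RB 𝒜 L M 𝓜 r
  | 0, M, _, _, 𝓜, r, h => h
  | L + 1, M, _, _, 𝓜, r, h => by
    refine ⟨Empty, inferInstance, fun _ => 0, 0, fun a => a.elim, ?_, ?_, ?_⟩
    · intro o x _; exact zero_mem _
    · intro o x _; exact ⟨0, zero_mem _, Subsingleton.elim _ _⟩
    · exact RB_of_subsingleton L _ _ _ inferInstance

theorem RB_mono_right : ∀ (L : ℕ) (M : Type u) [AddCommGroup M] [Module A M]
    (𝓜 : GM 𝒜 M) (r s : ℕ), r ≤ s → RB 𝒜 L M 𝓜 r → RB 𝒜 L M 𝓜 s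
  | 0, M, _, _, 𝓜, r, s, _, h => h
  | L + 1, M, _, _, 𝓜, r, s, hrs, h => by
    obtain ⟨ι, hι, d, e, h1, h2, h3, h4⟩ := h
    exact ⟨ι, hι, d, e, fun a => (h1 a).trans hrs, h2, h3,
      RB_mono_right L _ _ _ _ (by omega) h4⟩

theorem RB_mono_left : ∀ (L L' : ℕ) (M : Type u) [AddCommGroup M] [Module A M]
    (𝓜 : GM 𝒜 M) (r : ℕ), L ≤ L' → RB 𝒜 L M 𝓜 r → RB 𝒜 L' M 𝓜 r
  | 0, L', M, _, _, 𝓜, r, _, h => RB_of_subsingleton L' M 𝓜 r h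
  | L + 1, 0, M, _, _, 𝓜, r, hl, h => by omega
  | L + 1, L' + 1, M, _, _, 𝓜, r, hl, h => by
    obtain ⟨ι, hι, d, e, h1, h2, h3, h4⟩ := h
    exact ⟨ι, hι, d, e, h1, h2, h3, RB_mono_left L L' _ _ _ (by omega) h4⟩

structure SES (f : M →ₗ[A] N) (g : N →ₗ[A] P) (𝓜 : GM 𝒜 M) (𝓝 : GM 𝒜 N) (𝓟 : GM 𝒜 P) :
    Prop where
  inj : ∀ x, f x = 0 → x = 0
  mem : ∀ o x, x ∈ 𝓜.g o ↔ f x ∈ 𝓝.g o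
  gh : GH g 𝓝 𝓟
  gs : GS g 𝓝 𝓟
  ex : ∀ y, g y = 0 ↔ ∃ x, f x = y

theorem mem_free_sum {ι κ : Type} (d : ι → ℕ) (d' : κ → ℕ) (o : Option ℕ) (h : ι ⊕ κ → A) :
    h ∈ (freeGr 𝒜 (Sum.elim d d')).g o ↔
      (h ∘ Sum.inl) ∈ (freeGr 𝒜 d).g o ∧ (h ∘ Sum.inr) ∈ (freeGr 𝒜 d').g o := by
  cases o with
  | none => simp [GM.g]
  | some n =>
    simp only [GM.g, mem_freeGr, Sum.forall, Function.comp, Sum.elim_inl, Sum.elim_inr]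

theorem horseshoe : ∀ (L : ℕ) (M N P : Type u) [AddCommGroup M] [Module A M]
    [AddCommGroup N] [Module A N] [AddCommGroup P] [Module A P]
    (f : M →ₗ[A] N) (g : N →ₗ[A] P) (𝓜 : GM 𝒜 M) (𝓝 : GM 𝒜 N) (𝓟 : GM 𝒜 P) (r : ℕ),
    SES f g 𝓜 𝓝 𝓟 → RB 𝒜 L M 𝓜 r → RB 𝒜 L P 𝓟 r → RB 𝒜 L N 𝓝 r
  | 0, M, N, P, _, _, _, _, _, _, f, g, 𝓜, 𝓝, 𝓟, r, S, h1, h3 => by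
    have h1 : Subsingleton M := h1
    have h3 : Subsingleton P := h3
    refine subsingleton_of_forall_eq (0 : N) fun y => ?_
    obtain ⟨x, rfl⟩ := (S.ex y).1 (Subsingleton.elim _ _)
    rw [Subsingleton.elim x 0, map_zero]
  | L + 1, M, N, P, _, _, _, _, _, _, f, g, 𝓜, 𝓝, 𝓟, r, S, h1, h3 => by
    classical
    obtain ⟨ι, hι, d, e, hd, eh, es, hr⟩ := h1
    obtain ⟨κ, hκ, d', e', hd', eh', es', hr'⟩ := h3
    have hy : ∀ a : κ, ∃ y ∈ 𝓝.gr (d' a), g y = e' (Pi.single a 1) := fun a =>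
      S.gs (some (d' a)) _ (eh' (some (d' a)) _ (single_mem_freeGr d' a))
    choose y hy hgy using hy
    let ψ : (κ → A) →ₗ[A] N := Fintype.linearCombination A y
    have hψ : GH ψ (freeGr 𝒜 d') 𝓝 := GH_lincomb d' y 𝓝 hy
    have hgψ : ∀ h, g (ψ h) = e' h := by
      have : g ∘ₗ ψ = e' := by
        refine LinearMap.pi_ext' fun a => LinearMap.ext_ring ?_
        simp [ψ, hgy, Fintype.linearCombination_apply_single]
      intro h; rw [← this]; rfl
    let E : (ι ⊕ κ → A) →ₗ[A] N :=
      f ∘ₗ e ∘ₗ LinearMap.funLeft A A Sum.inl + ψ ∘ₗ LinearMap.funLeft A A Sum.inr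
    have hE : ∀ h, E h = f (e (h ∘ Sum.inl)) + ψ (h ∘ Sum.inr) := fun h => rfl
    have hgE : ∀ h, g (E h) = e' (h ∘ Sum.inr) := fun h => by
      rw [hE, map_add, hgψ, (S.ex _).2 ⟨_, rfl⟩, zero_add]
    have key : ∀ o, ∀ y ∈ 𝓝.g o, ∀ h' ∈ (freeGr 𝒜 d').g o, g y = e' h' →
        ∃ h ∈ (freeGr 𝒜 (Sum.elim d d')).g o, E h = y ∧ h ∘ Sum.inr = h' := by
      intro o y hy h' hh' hyh
      obtain ⟨x, hx⟩ := (S.ex (y - ψ h')).1 (by rw [map_sub, hgψ, hyh, sub_self])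
      have hxm : x ∈ 𝓜.g o := (S.mem o x).2 (by rw [hx]; exact sub_mem hy (hψ o _ hh'))
      obtain ⟨h, hh, rfl⟩ := es o x hxm
      refine ⟨Sum.elim h h', (mem_free_sum d d' o _).2 ⟨by simpa using hh, by simpa using hh'⟩,
        ?_, by simp⟩
      rw [hE]; simp [hx]
    refine ⟨ι ⊕ κ, inferInstance, Sum.elim d d', E, ?_, ?_, ?_, ?_⟩
    · rintro (a | a)
      · exact hd a
      · exact hd' a
    · intro o h hh
      rw [mem_free_sum] at hh
      exact add_mem ((S.mem o _).1 (eh o _ hh.1)) (hψ o _ hh.2)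
    · intro o y hy
      obtain ⟨h', hh', he⟩ := es' o (g y) (S.gh o y hy)
      obtain ⟨h, h1, h2, -⟩ := key o y hy h' hh' he.symm
      exact ⟨h, h1, h2⟩
    · let F : (ι → A) →ₗ[A] (ι ⊕ κ → A) :=
        { toFun := fun h => Sum.elim h 0
          map_add' := fun x y => by ext (a | a) <;> simp
          map_smul' := fun c x => by ext (a | a) <;> simp }
      have hF1 : ∀ h, F h ∘ Sum.inl = h := fun h => rfl
      have hF2 : ∀ h, F h ∘ Sum.inr = 0 := fun h => rfl
      have hEF : ∀ h, E (F h) = f (e h) := fun h => by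
        rw [hE, hF1, hF2, map_zero, add_zero]
      let F' : LinearMap.ker e →ₗ[A] LinearMap.ker E :=
        F.restrict (fun x hx => by
          rw [LinearMap.mem_ker] at *; rw [hEF, hx, map_zero])
      let G' : LinearMap.ker E →ₗ[A] LinearMap.ker e' :=
        (LinearMap.funLeft A A (Sum.inr : κ → ι ⊕ κ)).restrict (fun x hx => by
          rw [LinearMap.mem_ker] at *
          have := hgE x
          rw [hx, map_zero] at this
          exact this.symm)
      refine horseshoe L _ _ _ F' G' _ _ _ _ ⟨?_, ?_, ?_, ?_, ?_⟩ hr hr'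
      · rintro ⟨x, hx⟩ h
        have : F x = 0 := congrArg Subtype.val h
        ext a
        exact congrFun this (Sum.inl a)
      · rintro o ⟨x, hx⟩
        rw [GM.mem_comap, GM.mem_comap]
        change x ∈ _ ↔ F x ∈ _
        rw [mem_free_sum, hF1, hF2]
        simp [zero_mem]
      · rintro o ⟨x, hx⟩ h
        rw [GM.mem_comap] at *
        exact ((mem_free_sum _ _ _ _).1 h).2
      · rintro o ⟨x, hx⟩ h
        rw [GM.mem_comap] at h
        obtain ⟨z, h1, h2, h3⟩ := key o 0 (zero_mem _) x h (by
          rw [LinearMap.mem_ker] at hx; rw [hx, map_zero])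
        exact ⟨⟨z, h2⟩, (GM.mem_comap _ _ _ _).2 h1, Subtype.ext h3⟩
      · rintro ⟨x, hx⟩
        constructor
        · intro h
          have h0 : x ∘ Sum.inr = 0 := congrArg Subtype.val h
          have hx' := hx
          rw [LinearMap.mem_ker, hE, h0, map_zero, add_zero] at hx'
          refine ⟨⟨x ∘ Sum.inl, S.inj _ hx'⟩, Subtype.ext ?_⟩
          funext a
          rcases a with a | a
          · rfl
          · exact (congrFun h0 a).symm
        · rintro ⟨z, hz⟩
          have : F z = x := congrArg Subtype.val hz
          refine Subtype.ext ?_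
          change x ∘ Sum.inr = 0
          rw [← this, hF2]

/-- mapping cone -/
theorem cone (L : ℕ) (M N P : Type u) [AddCommGroup M] [Module A M]
    [AddCommGroup N] [Module A N] [AddCommGroup P] [Module A P]
    (f : M →ₗ[A] N) (g : N →ₗ[A] P) (𝓜 : GM 𝒜 M) (𝓝 : GM 𝒜 N) (𝓟 : GM 𝒜 P) (r : ℕ)
    (S : SES f g 𝓜 𝓝 𝓟) (h1 : RB 𝒜 L M 𝓜 (r + 1)) (h2 : RB 𝒜 (L + 1) N 𝓝 r) :
    RB 𝒜 (L + 1) P 𝓟 r := by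
  obtain ⟨ι, hι, d, e, hd, eh, es, hr⟩ := h2
  refine ⟨ι, hι, d, g ∘ₗ e, hd, fun o x hx => S.gh o _ (eh o x hx), ?_, ?_⟩
  · intro o y hy
    obtain ⟨x, hx, rfl⟩ := S.gs o y hy
    obtain ⟨z, hz, rfl⟩ := es o x hx
    exact ⟨z, hz, rfl⟩
  · have finj : Function.Injective f := (injective_iff_map_eq_zero f).2 S.inj
    let φ := LinearEquiv.ofInjective f finj
    have hφ : ∀ y, f (φ.symm y) = y := fun y => congrArg Subtype.val (φ.apply_symm_apply y)
    let q : LinearMap.ker (g ∘ₗ e) →ₗ[A] M := φ.symm.toLinearMap ∘ₗ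
      e.restrict (p := LinearMap.ker (g ∘ₗ e)) (q := LinearMap.range f)
        (fun x hx => (S.ex (e x)).1 hx)
    have hq : ∀ x, f (q x) = e x := fun x => hφ _
    let i : LinearMap.ker e →ₗ[A] LinearMap.ker (g ∘ₗ e) :=
      Submodule.inclusion (LinearMap.ker_le_ker_comp e g)
    refine horseshoe L _ _ _ i q _ _ _ _ ⟨?_, ?_, ?_, ?_, ?_⟩ hr h1
    · rintro ⟨x, hx⟩ h
      have : x = 0 := congrArg Subtype.val h
      exact Subtype.ext this
    · rintro o ⟨x, hx⟩
      rw [GM.mem_comap, GM.mem_comap]; rfl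
    · rintro o x h
      rw [GM.mem_comap] at h
      rw [S.mem, hq]
      exact eh o _ h
    · intro o y hy
      obtain ⟨x, hx, hxy⟩ := es o (f y) ((S.mem o y).1 hy)
      refine ⟨⟨x, ?_⟩, (GM.mem_comap _ _ _ _).2 hx, finj ?_⟩
      · rw [LinearMap.mem_ker, LinearMap.comp_apply, hxy]; exact (S.ex _).2 ⟨y, rfl⟩
      · rw [hq]; exact hxy
    · intro x
      constructor
      · intro h
        refine ⟨⟨x, ?_⟩, rfl⟩
        rw [LinearMap.mem_ker, ← hq, h, map_zero]
      · rintro ⟨z, rfl⟩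
        refine finj ?_
        rw [hq, map_zero]; exact z.2

def ERB (𝒜 : ℕ → Submodule K A) [SetLike.GradedMonoid 𝒜] (M : Type u) [AddCommGroup M]
    [Module A M] (𝓜 : GM 𝒜 M) (r : ℕ) : Prop := ∃ L, RB 𝒜 L M 𝓜 r

theorem ERB.mono {𝓜 : GM 𝒜 M} {r s : ℕ} (h : ERB 𝒜 M 𝓜 r) (hrs : r ≤ s) : ERB 𝒜 M 𝓜 s := by
  obtain ⟨L, h⟩ := h
  exact ⟨L, RB_mono_right _ _ _ _ _ hrs h⟩

theorem ERB.mid {f : M →ₗ[A] N} {g : N →ₗ[A] P} {𝓜 : GM 𝒜 M} {𝓝 : GM 𝒜 N} {𝓟 : GM 𝒜 P} {r : ℕ}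
    (S : SES f g 𝓜 𝓝 𝓟) (h1 : ERB 𝒜 M 𝓜 r) (h2 : ERB 𝒜 P 𝓟 r) : ERB 𝒜 N 𝓝 r := by
  obtain ⟨L, h1⟩ := h1
  obtain ⟨L', h2⟩ := h2
  exact ⟨max L L', horseshoe _ _ _ _ f g _ _ _ _ S
    (RB_mono_left _ _ _ _ _ (le_max_left _ _) h1) (RB_mono_left _ _ _ _ _ (le_max_right _ _) h2)⟩

theorem ERB.right {f : M →ₗ[A] N} {g : N →ₗ[A] P} {𝓜 : GM 𝒜 M} {𝓝 : GM 𝒜 N} {𝓟 : GM 𝒜 P}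
    {r : ℕ} (S : SES f g 𝓜 𝓝 𝓟) (h1 : ERB 𝒜 M 𝓜 (r + 1)) (h2 : ERB 𝒜 N 𝓝 r) :
    ERB 𝒜 P 𝓟 r := by
  obtain ⟨L, h1⟩ := h1
  obtain ⟨L', h2⟩ := h2
  exact ⟨max L L' + 1, cone _ _ _ _ f g _ _ _ _ S
    (RB_mono_left _ _ _ _ _ (le_max_left _ _) h1)
    (RB_mono_left _ _ _ _ _ (by have := le_max_right L L'; omega) h2)⟩

theorem ERB.step {𝓜 : GM 𝒜 M} {r : ℕ} {ι : Type} [hι : Fintype ι] (d : ι → ℕ)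
    (e : (ι → A) →ₗ[A] M) (hd : ∀ a, d a ≤ r) (eh : GH e (freeGr 𝒜 d) 𝓜)
    (es : GS e (freeGr 𝒜 d) 𝓜)
    (h : ERB 𝒜 (LinearMap.ker e) ((freeGr 𝒜 d).comap (LinearMap.ker e).subtype) (r + 1)) :
    ERB 𝒜 M 𝓜 r := by
  obtain ⟨L, h⟩ := h
  exact ⟨L + 1, ι, hι, d, e, hd, eh, es, h⟩

theorem ERB.free {r : ℕ} {ι : Type} [Fintype ι] (d : ι → ℕ) (hd : ∀ a, d a ≤ r) :
    ERB 𝒜 (ι → A) (freeGr 𝒜 d) r := by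
  refine ERB.step d LinearMap.id hd (fun o x hx => hx) (fun o x hx => ⟨x, hx, rfl⟩)
    ⟨0, ?_⟩
  change Subsingleton _
  rw [LinearMap.ker_id]; infer_instance

theorem mem_freeGr_succ {ι : Type} (d : ι → ℕ) (o : Option ℕ) (f : ι → A) :
    f ∈ (freeGr 𝒜 (fun a => d a + 1)).g o ↔ f ∈ (freeGr 𝒜 d).shift.g o := by
  rcases o with - | - | n
  · rfl
  · constructor
    · intro h
      have : f = 0 := funext fun a => (h a).2 (Nat.succ_pos _)
      rw [this]; exact zero_mem _
    · intro h
      have : f = 0 := h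
      rw [this]; exact zero_mem _
  · change (∀ a, _) ↔ (∀ a, _)
    simp

theorem RB_congr : ∀ (L : ℕ) (M : Type u) [AddCommGroup M] [Module A M]
    (𝓜 𝓜' : GM 𝒜 M) (r : ℕ), (∀ o x, x ∈ 𝓜.g o ↔ x ∈ 𝓜'.g o) → RB 𝒜 L M 𝓜 r → RB 𝒜 L M 𝓜' r
  | 0, M, _, _, 𝓜, 𝓜', r, _, h => h
  | L + 1, M, _, _, 𝓜, 𝓜', r, hm, h => by
    obtain ⟨ι, hι, d, e, h1, h2, h3, h4⟩ := h
    exact ⟨ι, hι, d, e, h1, fun o x hx => (hm o _).1 (h2 o x hx),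
      fun o x hx => h3 o x ((hm o _).2 hx), h4⟩

theorem RB_shift : ∀ (L : ℕ) (M : Type u) [AddCommGroup M] [Module A M]
    (𝓜 : GM 𝒜 M) (r : ℕ), RB 𝒜 L M 𝓜 r → RB 𝒜 L M 𝓜.shift (r + 1)
  | 0, M, _, _, 𝓜, r, h => h
  | L + 1, M, _, _, 𝓜, r, h => by
    obtain ⟨ι, hι, d, e, h1, h2, h3, h4⟩ := h
    refine ⟨ι, hι, fun a => d a + 1, e, fun a => Nat.succ_le_succ (h1 a), ?_, ?_, ?_⟩
    · intro o x hx
      exact h2.shift o x ((mem_freeGr_succ d o x).1 hx)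
    · intro o y hy
      obtain ⟨x, hx, h⟩ := h3.shift o y hy
      exact ⟨x, (mem_freeGr_succ d o x).2 hx, h⟩
    · refine RB_congr L _ _ _ _ ?_ (RB_shift L _ _ _ h4)
      intro o x
      rw [GM.mem_comap, mem_freeGr_succ]
      rcases o with - | - | n
      · exact Iff.rfl
      · exact Subtype.ext_iff
      · exact Iff.rfl

theorem ERB.shift {𝓜 : GM 𝒜 M} {r : ℕ} (h : ERB 𝒜 M 𝓜 r) : ERB 𝒜 M 𝓜.shift (r + 1) := by
  obtain ⟨L, h⟩ := h
  exact ⟨L, RB_shift _ _ _ _ h⟩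


end GradedRB

section ChangeRing

universe u w

variable {K : Type w} [CommRing K] {A : Type u} [CommRing A] [Algebra K A]
    {𝒜 : ℕ → Submodule K A} [SetLike.GradedMonoid 𝒜]
    {B : Type u} [CommRing B] [Algebra K B]
    {ℬ : ℕ → Submodule K B} [SetLike.GradedMonoid ℬ] [Algebra B A] {v : B}

/-- `A = B/(v)` as graded rings, `v` regular of degree one -/
structure CR (ℬ : ℕ → Submodule K B) (𝒜 : ℕ → Submodule K A) (v : B) : Prop where
  surj : ∀ x : A, ∃ y, algebraMap B A y = x
  surjg : ∀ n, ∀ x ∈ 𝒜 n, ∃ y ∈ ℬ n, algebraMap B A y = x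
  map_mem : ∀ n, ∀ y ∈ ℬ n, algebraMap B A y ∈ 𝒜 n
  ker : ∀ y, algebraMap B A y = 0 → ∃ z, y = v * z
  v_ker : algebraMap B A v = 0
  v_mem : v ∈ ℬ 1
  reg0 : ∀ y, v * y = 0 → y = 0
  regs : ∀ n y, v * y ∈ ℬ (n + 1) → y ∈ ℬ n
  regz : ∀ y, v * y ∈ ℬ 0 → y = 0

variable {M : Type u} [AddCommGroup M] [Module A M] [Module B M] [IsScalarTower B A M]

def GM.restr (h : CR ℬ 𝒜 v) (𝓜 : GM 𝒜 M) : GM ℬ M where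
  gr := 𝓜.gr
  smul_mem m n a x ha hx := by
    have := 𝓜.smul_mem m n _ x (h.map_mem m a ha) hx
    rwa [algebraMap_smul] at this

theorem GM.mem_restr (h : CR ℬ 𝒜 v) (𝓜 : GM 𝒜 M) (o : Option ℕ) (x : M) :
    x ∈ (𝓜.restr h).g o ↔ x ∈ 𝓜.g o := by
  cases o <;> rfl

theorem CR.smul_zero' (h : CR ℬ 𝒜 v) (x : M) : v • x = 0 := by
  rw [← algebraMap_smul A v x, h.v_ker, zero_smul]

def thetaMap (B A : Type u) [CommRing B] [CommRing A] [Algebra B A] (ι : Type) :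
    (ι → B) →ₗ[B] (ι → A) := LinearMap.compLeft (Algebra.linearMap B A) ι

theorem thetaMap_apply {ι : Type} (f : ι → B) (a : ι) :
    thetaMap B A ι f a = algebraMap B A (f a) := rfl

theorem theta_GH (h : CR ℬ 𝒜 v) {ι : Type} (d : ι → ℕ) (o : Option ℕ) (f : ι → B)
    (hf : f ∈ (freeGr ℬ d).g o) : thetaMap B A ι f ∈ (freeGr 𝒜 d).g o := by
  cases o with
  | none => trivial
  | some n =>
    intro a
    refine ⟨h.map_mem _ _ (hf a).1, fun hn => ?_⟩
    rw [thetaMap_apply, (hf a).2 hn, map_zero]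

theorem theta_GS (h : CR ℬ 𝒜 v) {ι : Type} (d : ι → ℕ) (o : Option ℕ) (f : ι → A)
    (hf : f ∈ (freeGr 𝒜 d).g o) : ∃ f' ∈ (freeGr ℬ d).g o, thetaMap B A ι f' = f := by
  cases o with
  | none =>
    choose f' hf' using fun a => h.surj (f a)
    exact ⟨f', trivial, funext hf'⟩
  | some n =>
    have : ∀ a, ∃ y, (y ∈ ℬ (n - d a) ∧ (n < d a → y = 0)) ∧ algebraMap B A y = f a := by
      intro a
      by_cases hn : n < d a
      · exact ⟨0, ⟨zero_mem _, fun _ => rfl⟩, by rw [(hf a).2 hn, map_zero]⟩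
      · obtain ⟨y, hy, hy'⟩ := h.surjg _ _ (hf a).1
        exact ⟨y, ⟨hy, fun h' => absurd h' hn⟩, hy'⟩
    choose f' hf' hff' using this
    exact ⟨f', hf', funext hff'⟩

theorem theta_ker (h : CR ℬ 𝒜 v) {ι : Type} (f : ι → B) (hf : thetaMap B A ι f = 0) :
    ∃ f', f = v • f' := by
  choose f' hf' using fun a => h.ker (f a) (congrFun hf a)
  exact ⟨f', funext hf'⟩

theorem theta_v (h : CR ℬ 𝒜 v) {ι : Type} (f : ι → B) : thetaMap B A ι (v • f) = 0 := by
  rw [map_smul]; exact h.smul_zero' _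

/-- `v` is (gradedly) regular on `N` -/
def TF (v : B) {N : Type u} [AddCommGroup N] [Module B N] (𝓝 : GM ℬ N) : Prop :=
  (∀ x : N, v • x = 0 → x = 0) ∧ ∀ o, ∀ x : N, v • x ∈ 𝓝.g o → x ∈ 𝓝.shift.g o

theorem TF_free (h : CR ℬ 𝒜 v) {ι : Type} (d : ι → ℕ) : TF v (freeGr ℬ d) := by
  refine ⟨fun f hf => funext fun a => h.reg0 _ (congrFun hf a), ?_⟩
  intro o f hf
  rcases o with - | - | n
  · trivial
  · refine funext fun a => h.regz _ ?_
    have := (hf a).1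
    simpa using this
  · intro a
    have h1 := (hf a)
    have hz : n < d a → f a = 0 := by
      intro hn
      by_cases h2 : n + 1 < d a
      · exact h.reg0 _ (h1.2 h2)
      · apply h.regz
        have h3 := h1.1
        have : n + 1 - d a = 0 := by omega
        rw [this] at h3; exact h3
    refine ⟨?_, hz⟩
    by_cases hn : n < d a
    · rw [hz hn]; exact zero_mem _
    · apply h.regs
      have : n - d a + 1 = n + 1 - d a := by omega
      rw [this]; exact h1.1

theorem TF_comap {N P : Type u} [AddCommGroup N] [Module B N] [AddCommGroup P] [Module B P]
    {𝓝 : GM ℬ N} (f : P →ₗ[B] N) (hf : ∀ x, f x = 0 → x = 0) (h : TF v 𝓝) :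
    TF v (𝓝.comap f) := by
  refine ⟨fun x hx => hf x (h.1 _ (by rw [← map_smul, hx, map_zero])), ?_⟩
  intro o x hx
  rw [GM.mem_comap, map_smul] at hx
  have := h.2 o _ hx
  rcases o with - | - | n
  · trivial
  · exact hf _ this
  · exact this

theorem v_smul_mem {N : Type u} [AddCommGroup N] [Module B N] (hv : v ∈ ℬ 1)
    (𝓝 : GM ℬ N) (o : Option ℕ) (x : N) (hx : x ∈ 𝓝.shift.g o) : v • x ∈ 𝓝.g o := by
  rcases o with - | - | n
  · trivial
  · have : x = 0 := hx
    rw [this, smul_zero]; exact zero_mem _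
  · have := 𝓝.smul_mem 1 n v x hv hx
    rwa [add_comm] at this

theorem ERB_free_restr (h : CR ℬ 𝒜 v) {ι : Type} [Fintype ι] (d : ι → ℕ) (r : ℕ)
    (hd : ∀ a, d a ≤ r) : ERB ℬ (ι → A) ((freeGr 𝒜 d).restr h) r := by
  have tf := TF_free h d
  refine ERB.right (f := (v • LinearMap.id : (ι → B) →ₗ[B] (ι → B))) (g := thetaMap B A ι)
    (𝓜 := (freeGr ℬ d).shift) (𝓝 := freeGr ℬ d) ⟨?_, ?_, ?_, ?_, ?_⟩ ?_ ?_
  · intro x hx; exact tf.1 x hx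
  · intro o x
    exact ⟨v_smul_mem h.v_mem _ o x, tf.2 o x⟩
  · intro o x hx
    rw [GM.mem_restr]; exact theta_GH h d o x hx
  · intro o x hx
    rw [GM.mem_restr] at hx; exact theta_GS h d o x hx
  · intro y
    constructor
    · intro hy
      obtain ⟨f, rfl⟩ := theta_ker h y hy
      exact ⟨f, rfl⟩
    · rintro ⟨f, rfl⟩; exact theta_v h f
  · exact (ERB.free d hd).shift
  · exact ERB.free d hd

theorem ERB_restr (h : CR ℬ 𝒜 v) : ∀ (L : ℕ) (M : Type u) [AddCommGroup M] [Module A M]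
    [Module B M] [IsScalarTower B A M] (𝓜 : GM 𝒜 M) (r : ℕ), RB 𝒜 L M 𝓜 r →
    ERB ℬ M (𝓜.restr h) r
  | 0, M, _, _, _, _, 𝓜, r, hM => ⟨0, hM⟩
  | L + 1, M, _, _, _, _, 𝓜, r, hM => by
    obtain ⟨ι, hι, d, e, hd, eh, es, hr⟩ := hM
    have IH := ERB_restr h L _ _ _ hr
    refine ERB.right (f := (LinearMap.ker e).subtype.restrictScalars B)
      (g := e.restrictScalars B) (𝓝 := (freeGr 𝒜 d).restr h) ⟨?_, ?_, ?_, ?_, ?_⟩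
      IH (ERB_free_restr h d r hd)
    · intro x hx; exact Subtype.ext hx
    · intro o x
      rw [GM.mem_restr, GM.mem_restr, GM.mem_comap]; rfl
    · intro o x hx
      rw [GM.mem_restr] at *; exact eh o x hx
    · intro o x hx
      rw [GM.mem_restr] at hx
      obtain ⟨y, hy, h'⟩ := es o x hx
      exact ⟨y, (GM.mem_restr _ _ _ _).2 hy, h'⟩
    · intro y
      exact ⟨fun hy => ⟨⟨y, hy⟩, rfl⟩, fun ⟨x, hx⟩ => by rw [← hx]; exact x.2⟩

/-- base change of a map from a free module -/
theorem exists_descend (h : CR ℬ 𝒜 v) {ι : Type} [Fintype ι] (e : (ι → B) →ₗ[B] M) :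
    ∃ e' : (ι → A) →ₗ[A] M, ∀ f, e' (thetaMap B A ι f) = e f := by
  classical
  refine ⟨Fintype.linearCombination A (fun a => e (Pi.single a 1)), ?_⟩
  have : (Fintype.linearCombination A (fun a => e (Pi.single a 1))).restrictScalars B ∘ₗ
      thetaMap B A ι = e := by
    refine LinearMap.pi_ext' fun a => LinearMap.ext_ring ?_
    have : thetaMap B A ι (Pi.single a 1) = Pi.single a 1 := by
      funext b
      rw [thetaMap_apply]
      by_cases hb : b = a
      · subst hb; simp
      · simp [Pi.single_eq_of_ne hb]
    simp [this, Fintype.linearCombination_apply_single]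
  intro f
  exact LinearMap.congr_fun this f

theorem RB_descend (h : CR ℬ 𝒜 v) : ∀ (L : ℕ) (N M : Type u) [AddCommGroup N] [Module B N]
    [AddCommGroup M] [Module A M] [Module B M] [IsScalarTower B A M]
    (𝓝 : GM ℬ N) (𝓜 : GM 𝒜 M) (r : ℕ) (q : N →ₗ[B] M), TF v 𝓝 →
    GH q 𝓝 (𝓜.restr h) → GS q 𝓝 (𝓜.restr h) → (∀ x, q x = 0 → ∃ y, x = v • y) →
    RB ℬ L N 𝓝 r → RB 𝒜 L M 𝓜 r
  | 0, N, M, _, _, _, _, _, _, 𝓝, 𝓜, r, q, tf, qh, qs, qk, hN => by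
    have hN : Subsingleton N := hN
    exact qs.surj.subsingleton
  | L + 1, N, M, _, _, _, _, _, _, 𝓝, 𝓜, r, q, tf, qh, qs, qk, hN => by
    obtain ⟨ι, hι, d, e, hd, eh, es, hr⟩ := hN
    obtain ⟨e', he'⟩ := exists_descend h (q ∘ₗ e)
    have key : ∀ o, ∀ f ∈ (freeGr ℬ d).g o, q (e f) = 0 →
        ∃ f' ∈ (freeGr ℬ d).g o, e f' = 0 ∧ thetaMap B A ι f' = thetaMap B A ι f := by
      intro o f hf hq
      obtain ⟨n, hn⟩ := qk _ hq
      have h1 : n ∈ 𝓝.shift.g o := tf.2 o n (by rw [← hn]; exact eh o f hf)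
      obtain ⟨f₂, hf₂, rfl⟩ := es.shift o n h1
      refine ⟨f - v • f₂, sub_mem hf (v_smul_mem h.v_mem _ o _ hf₂), ?_, ?_⟩
      · rw [map_sub, hn, map_smul, sub_self]
      · rw [map_sub, theta_v h, sub_zero]
    let Q : LinearMap.ker e →ₗ[B] LinearMap.ker e' :=
      { toFun := fun x => ⟨thetaMap B A ι x, by
          rw [LinearMap.mem_ker, he', LinearMap.comp_apply, x.2, map_zero]⟩
        map_add' := fun x y => Subtype.ext (by simp)
        map_smul' := fun c x => Subtype.ext (by simp) }
    refine ⟨ι, hι, d, e', hd, ?_, ?_, ?_⟩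
    · intro o x hx
      obtain ⟨f, hf, rfl⟩ := theta_GS h d o x hx
      rw [he', ← GM.mem_restr h]
      exact qh o _ (eh o f hf)
    · intro o x hx
      rw [← GM.mem_restr h] at hx
      obtain ⟨n, hn, rfl⟩ := qs o x hx
      obtain ⟨f, hf, rfl⟩ := es o n hn
      exact ⟨_, theta_GH h d o f hf, he' f⟩
    · refine RB_descend h L _ _ _ _ _ Q (TF_comap _ (fun x hx => Subtype.ext hx) (TF_free h d))
        ?_ ?_ ?_ hr
      · intro o x hx
        rw [GM.mem_restr, GM.mem_comap]
        exact theta_GH h d o _ ((GM.mem_comap _ _ _ _).1 hx)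
      · rintro o ⟨y, hy⟩ hyo
        rw [GM.mem_restr, GM.mem_comap] at hyo
        obtain ⟨f, hf, hfy⟩ := theta_GS h d o y hyo
        obtain ⟨f', hf', h1, h2⟩ := key o f hf (by
          have := he' f
          rw [hfy] at this
          rw [← LinearMap.comp_apply, ← this]; exact hy)
        exact ⟨⟨f', h1⟩, (GM.mem_comap _ _ _ _).2 hf', Subtype.ext (h2.trans hfy)⟩
      · rintro ⟨x, hx⟩ hQ
        obtain ⟨f, rfl⟩ := theta_ker h x (congrArg Subtype.val hQ)
        rw [LinearMap.mem_ker, map_smul] at hx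
        exact ⟨⟨f, tf.1 _ hx⟩, rfl⟩

theorem exists_module (h : CR ℬ 𝒜 v) (Q : Type u) [AddCommGroup Q] [Module B Q]
    (hQ : ∀ x : Q, v • x = 0) : ∃ _ : Module A Q, IsScalarTower B A Q := by
  have hs : Function.Surjective (algebraMap B A) := h.surj
  let I : SMul A Q := ⟨fun a x => Function.surjInv hs a • x⟩
  have key : ∀ (c : B) (x : Q), algebraMap B A c • x = c • x := by
    intro c x
    change Function.surjInv hs (algebraMap B A c) • x = c • x
    obtain ⟨z, hz⟩ := h.ker (Function.surjInv hs (algebraMap B A c) - c)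
      (by rw [map_sub, Function.surjInv_eq hs, sub_self])
    rw [← sub_eq_zero, ← sub_smul, hz, mul_smul, hQ]
  let J : Module A Q := Function.Surjective.moduleLeft (algebraMap B A) hs key
  exact ⟨J, IsScalarTower.of_algebraMap_smul key⟩

theorem ERB_improve (h : CR ℬ 𝒜 v) (𝓜 : GM 𝒜 M) (r s t : ℕ)
    (h1 : ERB ℬ M (𝓜.restr h) r) (h2 : ERB 𝒜 M 𝓜 s) (hr : r ≤ t) (hs : s ≤ t + 1) :
    ERB 𝒜 M 𝓜 t := by
  obtain ⟨L, h1⟩ := h1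
  cases L with
  | zero => exact ⟨0, h1⟩
  | succ L =>
  obtain ⟨ι, hι, d, e, hd, eh, es, hN⟩ := h1
  obtain ⟨e', he'⟩ := exists_descend h e
  have tfF := TF_free h d
  have tfN : TF v ((freeGr ℬ d).comap (LinearMap.ker e).subtype) :=
    TF_comap _ (fun x hx => Subtype.ext hx) tfF
  let vN : LinearMap.ker e →ₗ[B] LinearMap.ker e := v • LinearMap.id
  let Q := (LinearMap.ker e) ⧸ LinearMap.range vN
  let q : LinearMap.ker e →ₗ[B] Q := (LinearMap.range vN).mkQ
  have hq0 : ∀ x, q x = 0 ↔ ∃ y, x = v • y := by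
    intro x
    rw [← LinearMap.mem_ker, Submodule.ker_mkQ, LinearMap.mem_range]
    exact ⟨fun ⟨y, hy⟩ => ⟨y, hy.symm⟩, fun ⟨y, hy⟩ => ⟨y, hy.symm⟩⟩
  have hqs : Function.Surjective q := Submodule.mkQ_surjective _
  have hvQ : ∀ x : Q, v • x = 0 := by
    intro x
    obtain ⟨y, rfl⟩ := hqs x
    rw [← map_smul]; exact (hq0 _).2 ⟨y, rfl⟩
  obtain ⟨I1, I2⟩ := exists_module h Q hvQ
  let 𝓠' : GM ℬ Q := ((freeGr ℬ d).comap (LinearMap.ker e).subtype).map q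
  let 𝓠 : GM 𝒜 Q :=
    { gr := 𝓠'.gr
      smul_mem := by
        intro m n a x ha hx
        obtain ⟨b, hb, rfl⟩ := h.surjg m a ha
        rw [algebraMap_smul]
        exact 𝓠'.smul_mem m n b x hb hx }
  have qh : GH q ((freeGr ℬ d).comap (LinearMap.ker e).subtype) (𝓠.restr h) :=
    GH.mk fun n x hx => ⟨x, hx, rfl⟩
  have qs : GS q ((freeGr ℬ d).comap (LinearMap.ker e).subtype) (𝓠.restr h) := by
    intro o x hx
    cases o with
    | none =>
      obtain ⟨y, rfl⟩ := hqs x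
      exact ⟨y, trivial, rfl⟩
    | some n =>
      obtain ⟨y, hy, rfl⟩ := hx
      exact ⟨y, hy, rfl⟩
  have hQ : ERB 𝒜 Q 𝓠 (t + 1) := by
    have := RB_descend h L _ _ _ 𝓠 (r + 1) q tfN qh qs (fun x hx => (hq0 x).1 hx) hN
    exact ERB.mono ⟨L, this⟩ (by omega)
  have hsurj : Function.Surjective (algebraMap B A) := h.surj
  have memN : ∀ f : ι → B, v • f ∈ LinearMap.ker e := by
    intro f
    rw [LinearMap.mem_ker, map_smul]; exact h.smul_zero' _
  let α : (ι → B) →ₗ[B] Q := q ∘ₗ (v • LinearMap.id : (ι → B) →ₗ[B] (ι → B)).codRestrict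
    (LinearMap.ker e) memN
  have hα : ∀ f, α f = q ⟨v • f, memN f⟩ := fun f => rfl
  have hα0 : ∀ f, α f = 0 ↔ e f = 0 := by
    intro f
    rw [hα, hq0]
    constructor
    · rintro ⟨y, hy⟩
      have : v • f = v • (y : ι → B) := congrArg Subtype.val hy
      have : v • (f - y) = 0 := by rw [smul_sub, this, sub_self]
      rw [sub_eq_zero.1 (tfF.1 _ this)]; exact y.2
    · intro hf
      exact ⟨⟨f, hf⟩, rfl⟩
  let β : M →ₗ[B] Q := ((LinearMap.ker e).liftQ α (fun f hf => (hα0 f).2 hf)) ∘ₗ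
    (e.quotKerEquivOfSurjective es.surj).symm.toLinearMap
  have hβ : ∀ f, β (e f) = α f := by
    intro f
    have : (e.quotKerEquivOfSurjective es.surj).symm (e f) = (LinearMap.ker e).mkQ f := by
      rw [LinearEquiv.symm_apply_eq]; rfl
    change ((LinearMap.ker e).liftQ α (fun f hf => (hα0 f).2 hf)) ((e.quotKerEquivOfSurjective es.surj).symm (e f)) = _
    rw [this]; rfl
  let δ : LinearMap.ker e →ₗ[B] LinearMap.ker e' :=
    { toFun := fun x => ⟨thetaMap B A ι x, by rw [LinearMap.mem_ker, he', x.2]⟩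
      map_add' := fun x y => Subtype.ext (by simp)
      map_smul' := fun c x => Subtype.ext (by simp) }
  have hδ : ∀ x, (δ x : ι → A) = thetaMap B A ι x := fun x => rfl
  let γ : Q →ₗ[B] LinearMap.ker e' := (LinearMap.range vN).liftQ δ (by
    rintro _ ⟨y, rfl⟩
    exact Subtype.ext (theta_v h _))
  have hγ : ∀ x, γ (q x) = δ x := fun x => rfl
  have S : SES (β.extendScalarsOfSurjective hsurj) (γ.extendScalarsOfSurjective hsurj) 𝓜.shift 𝓠
      ((freeGr 𝒜 d).comap (LinearMap.ker e').subtype) := by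
    refine ⟨?_, ?_, ?_, ?_, ?_⟩
    · intro x hx
      obtain ⟨f, rfl⟩ := es.surj x
      have : β (e f) = 0 := hx
      rwa [hβ, hα0] at this
    · intro o x
      obtain ⟨f, rfl⟩ := es.surj x
      change _ ↔ β (e f) ∈ 𝓠.g o
      constructor
      · intro hx
        have hx' : e f ∈ (𝓜.restr h).shift.g o := by
          rcases o with - | - | n
          · trivial
          · exact hx
          · exact hx
        obtain ⟨f₁, hf₁, hf⟩ := es.shift o _ hx'
        rw [← hf, hβ, hα, ← GM.mem_restr h]
        refine qh o _ ?_
        rw [GM.mem_comap]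
        exact v_smul_mem h.v_mem _ o _ hf₁
      · intro hx
        rw [hβ, hα, ← GM.mem_restr h] at hx
        obtain ⟨y, hy, hyq⟩ := qs o _ hx
        obtain ⟨z, hz⟩ := (hq0 (⟨v • f, memN f⟩ - y)).1 (by rw [map_sub, hyq, sub_self])
        have hz' : v • f - (y : ι → B) = v • (z : ι → B) := congrArg Subtype.val hz
        have h3 : v • (f - z) = (y : ι → B) := by
          rw [smul_sub, ← hz']; abel
        have h4 := tfF.2 o (f - z) (by rw [h3]; exact (GM.mem_comap _ _ _ _).1 hy)
        have h5 := eh.shift o _ h4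
        have hz2 : e z = 0 := z.2
        rw [map_sub, hz2, sub_zero] at h5
        rcases o with - | - | n
        · trivial
        · exact h5
        · exact h5
    · intro o x hx
      rw [← GM.mem_restr h] at hx
      obtain ⟨y, hy, rfl⟩ := qs o _ hx
      rw [GM.mem_comap]
      exact theta_GH h d o _ ((GM.mem_comap _ _ _ _).1 hy)
    · rintro o ⟨y, hy⟩ hyo
      rw [GM.mem_comap] at hyo
      obtain ⟨f, hf, hfy⟩ := theta_GS h d o y hyo
      have hfe : e f = 0 := by rw [← he', hfy]; exact hy
      refine ⟨q ⟨f, hfe⟩, ?_, Subtype.ext hfy⟩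
      rw [← GM.mem_restr h]
      exact qh o _ ((GM.mem_comap _ _ _ _).2 hf)
    · intro y
      obtain ⟨x, rfl⟩ := hqs y
      constructor
      · intro hx
        obtain ⟨f, hf⟩ := theta_ker h (x : ι → B) (congrArg Subtype.val hx)
        refine ⟨e f, ?_⟩
        change β (e f) = _
        rw [hβ, hα]
        congr 1
        exact Subtype.ext hf.symm
      · rintro ⟨m, hm⟩
        obtain ⟨f, rfl⟩ := es.surj m
        have hm' : β (e f) = q x := hm
        rw [← hm', hβ, hα]
        exact Subtype.ext (theta_v h _)
  refine ERB.step d e' (fun a => (hd a).trans hr) ?_ ?_ (ERB.right S ?_ hQ)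
  · intro o x hx
    obtain ⟨f, hf, rfl⟩ := theta_GS h d o x hx
    rw [he', ← GM.mem_restr h]
    exact eh o _ hf
  · intro o x hx
    rw [← GM.mem_restr h] at hx
    obtain ⟨f, hf, rfl⟩ := es o x hx
    exact ⟨_, theta_GH h d o f hf, he' f⟩
  · exact h2.shift.mono (by omega)

end ChangeRing

section Convert

universe u₁ u₂

variable {K : Type u₁} [Field K] {σ : Type u₂}


def Ind {M : Type (max u₁ u₂)} [AddCommGroup M] [Module (MvPolynomial σ K) M] (𝓜 : GM (homogeneousSubmodule σ K) M) : Prop :=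
  ∀ (N : ℕ) (y : ℕ → M), (∀ m, y m ∈ 𝓜.gr m) → ∑ m ∈ Finset.range N, y m = 0 →
    ∀ m < N, y m = 0

theorem Ind_comap {M N : Type (max u₁ u₂)} [AddCommGroup M] [Module (MvPolynomial σ K) M] [AddCommGroup N]
    [Module (MvPolynomial σ K) N] (f : N →ₗ[(MvPolynomial σ K)] M) (hf : ∀ x, f x = 0 → x = 0) (𝓜 : GM (homogeneousSubmodule σ K) M) (h : Ind 𝓜) :
    Ind (𝓜.comap f) := by
  intro n y hy hs m hm
  refine hf _ (h n (fun m => f (y m)) hy ?_ m hm)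
  rw [← map_sum, hs, map_zero]

theorem Ind_free {ι : Type} (d : ι → ℕ) : Ind (freeGr (homogeneousSubmodule σ K) d) := by
  intro N y hy hs m hm
  funext a
  by_cases hma : m < d a
  · exact (hy m a).2 hma
  have h1 : ∑ k ∈ Finset.range N, y k a = 0 := by
    have := congrFun hs a
    simpa using this
  have h2 := congrArg (homogeneousComponent (m - d a)) h1
  rw [map_sum, map_zero, Finset.sum_eq_single m] at h2
  · rwa [homogeneousComponent_of_mem (hy m a).1, if_pos rfl] at h2
  · intro b _ hb
    by_cases hba : b < d a
    · rw [(hy b a).2 hba, map_zero]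
    · rw [homogeneousComponent_of_mem (hy b a).1, if_neg (by omega)]
  · intro h; exact absurd (Finset.mem_range.2 hm) h

theorem free_full {ι : Type} [Fintype ι] (d : ι → ℕ) (f : ι → (MvPolynomial σ K)) :
    ∃ (N : ℕ) (y : ℕ → ι → (MvPolynomial σ K)), (∀ m, y m ∈ (freeGr (homogeneousSubmodule σ K) d).gr m) ∧
      ∑ m ∈ Finset.range N, y m = f := by
  refine ⟨∑ a, (d a + ((f a).totalDegree + 1)), fun m a => if m < d a then 0 else
    homogeneousComponent (m - d a) (f a), ?_, ?_⟩
  · intro m a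
    by_cases h : m < d a
    · simp only [h, if_true]; exact ⟨zero_mem _, fun _ => trivial⟩
    · simp only [h, if_false]
      exact ⟨homogeneousComponent_mem _ _, fun h' => h'.elim⟩
  · funext a
    rw [Finset.sum_apply]
    have hle : d a + ((f a).totalDegree + 1) ≤ ∑ a, (d a + ((f a).totalDegree + 1)) :=
      Finset.single_le_sum (f := fun a => d a + ((f a).totalDegree + 1))
        (fun _ _ => Nat.zero_le _) (Finset.mem_univ a)
    obtain ⟨c, hc⟩ := Nat.exists_eq_add_of_le hle
    rw [hc, Finset.sum_range_add, Finset.sum_range_add, Finset.sum_eq_zero, zero_add]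
    · rw [Finset.sum_eq_zero (s := Finset.range c), add_zero]
      · conv_rhs => rw [← sum_homogeneousComponent (f a)]
        refine Finset.sum_congr rfl fun i _ => ?_
        rw [if_neg (by omega), Nat.add_sub_cancel_left]
      · intro i _
        rw [if_neg (by omega)]
        exact homogeneousComponent_eq_zero _ _ (by omega)
    · intro i hi
      rw [if_pos (Finset.mem_range.1 hi)]

variable {M : Type (max u₁ u₂)} [AddCommGroup M] [Module (MvPolynomial σ K) M]

theorem GS_of_surj {ι : Type} [Fintype ι] (d : ι → ℕ) (e : (ι → (MvPolynomial σ K)) →ₗ[(MvPolynomial σ K)] M) (𝓜 : GM (homogeneousSubmodule σ K) M)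
    (hI : Ind 𝓜) (eh : GH e (freeGr (homogeneousSubmodule σ K) d) 𝓜) (hs : Function.Surjective e) :
    GS e (freeGr (homogeneousSubmodule σ K) d) 𝓜 := by
  intro o x hx
  cases o with
  | none => obtain ⟨y, hy⟩ := hs x; exact ⟨y, trivial, hy⟩
  | some n =>
    obtain ⟨f, rfl⟩ := hs x
    obtain ⟨N, y, hy, rfl⟩ := free_full d f
    set x := e (∑ m ∈ Finset.range N, y m) with hxd
    have h0 := hI (N + (n + 1)) (fun m => (if m < N then e (y m) else 0) - if m = n then x else 0)
      ?_ ?_ n (by omega)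
    · by_cases hn : n < N
      · simp only [hn, if_true] at h0
        exact ⟨y n, hy n, sub_eq_zero.1 h0⟩
      · simp only [hn, if_false, if_true, zero_sub, neg_eq_zero] at h0
        exact ⟨0, zero_mem _, by rw [map_zero, h0]⟩
    · intro m
      refine sub_mem ?_ ?_
      · split_ifs
        · exact eh (some m) _ (hy m)
        · exact zero_mem _
      · split_ifs with h
        · subst h; exact hx
        · exact zero_mem _
    · rw [Finset.sum_sub_distrib, Finset.sum_ite_eq', if_pos (Finset.mem_range.2 (by omega)),
        Finset.sum_range_add, Finset.sum_eq_zero (s := Finset.range (n + 1)), add_zero, hxd,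
        map_sum, sub_eq_zero]
      · exact Finset.sum_congr rfl fun m hm => if_pos (Finset.mem_range.1 hm)
      · intro i _; rw [if_neg (by omega)]

theorem GH_of_single {ι : Type} [Fintype ι] [DecidableEq ι] (d : ι → ℕ) (e : (ι → (MvPolynomial σ K)) →ₗ[(MvPolynomial σ K)] M)
    (𝓜 : GM (homogeneousSubmodule σ K) M) (h : ∀ a, e (Pi.single a 1) ∈ 𝓜.gr (d a)) : GH e (freeGr (homogeneousSubmodule σ K) d) 𝓜 := by
  have : e = Fintype.linearCombination (MvPolynomial σ K) (fun a => e (Pi.single a 1)) := by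
    refine LinearMap.pi_ext' fun a => LinearMap.ext_ring ?_
    simp [Fintype.linearCombination_apply_single]
  rw [this]
  exact GH_lincomb d _ 𝓜 h

/-- the explicit resolution -/
def RES (M : Type (max u₁ u₂)) [AddCommGroup M] [Module (MvPolynomial σ K) M] (𝓜 : GM (homogeneousSubmodule σ K) M) (L r : ℕ) : Prop :=
  ∃ (k : ℕ → ℕ) (d : (i : ℕ) → Fin (k i) → ℕ)
    (φ : (i : ℕ) → ((Fin (k (i + 1)) →₀ (MvPolynomial σ K)) →ₗ[(MvPolynomial σ K)] (Fin (k i) →₀ (MvPolynomial σ K))))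
    (ε : (Fin (k 0) →₀ (MvPolynomial σ K)) →ₗ[(MvPolynomial σ K)] M),
    (∀ i, L ≤ i → k i = 0) ∧
    (∀ (i : ℕ) (b : Fin (k (i + 1))) (a : Fin (k i)),
      (φ i (Finsupp.single b 1)) a ∈ homogeneousSubmodule σ K (d (i + 1) b - d i a) ∧
      (d (i + 1) b < d i a → (φ i (Finsupp.single b 1)) a = 0)) ∧
    (∀ a : Fin (k 0), ε (Finsupp.single a 1) ∈ 𝓜.gr (d 0 a)) ∧
    Function.Surjective ε ∧
    LinearMap.range (φ 0) = LinearMap.ker ε ∧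
    (∀ i : ℕ, LinearMap.range (φ (i + 1)) = LinearMap.ker (φ i)) ∧
    (∀ (i : ℕ) (a : Fin (k i)), d i a ≤ i + r)

theorem RB_of_RES : ∀ (L : ℕ) (M : Type (max u₁ u₂)) [AddCommGroup M] [Module (MvPolynomial σ K) M]
    (𝓜 : GM (homogeneousSubmodule σ K) M) (r : ℕ), Ind 𝓜 → RES M 𝓜 L r → RB (homogeneousSubmodule σ K) L M 𝓜 r
  | 0, M, _, _, 𝓜, r, hI, h => by
    obtain ⟨k, d, φ, ε, h1, -, -, h4, -⟩ := h
    have hk : k 0 = 0 := h1 0 le_rfl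
    have : IsEmpty (Fin (k 0)) := by rw [hk]; infer_instance
    exact h4.subsingleton
  | L + 1, M, _, _, 𝓜, r, hI, h => by
    obtain ⟨k, d, φ, ε, h1, h2, h3, h4, h5, h6, h7⟩ := h
    let c : ∀ i, (Fin (k i) →₀ (MvPolynomial σ K)) ≃ₗ[(MvPolynomial σ K)] (Fin (k i) → (MvPolynomial σ K)) := fun i =>
      Finsupp.linearEquivFunOnFinite (MvPolynomial σ K) (MvPolynomial σ K) (Fin (k i))
    let e : (Fin (k 0) → (MvPolynomial σ K)) →ₗ[(MvPolynomial σ K)] M := ε ∘ₗ (c 0).symm.toLinearMap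
    have eh : GH e (freeGr (homogeneousSubmodule σ K) (d 0)) 𝓜 := by
      refine GH_of_single _ _ _ fun a => ?_
      change ε ((c 0).symm (Pi.single a 1)) ∈ _
      rw [Finsupp.linearEquivFunOnFinite_symm_single]
      exact h3 a
    have hs : Function.Surjective e := h4.comp (c 0).symm.surjective
    refine ⟨Fin (k 0), inferInstance, d 0, e, fun a => by simpa using h7 0 a, eh,
      GS_of_surj _ _ _ hI eh hs, ?_⟩
    have hmem : ∀ x, (c 0) (φ 0 x) ∈ LinearMap.ker e := by
      intro x
      rw [LinearMap.mem_ker]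
      change ε ((c 0).symm ((c 0) (φ 0 x))) = 0
      rw [LinearEquiv.symm_apply_apply, ← LinearMap.mem_ker, ← h5]
      exact ⟨x, rfl⟩
    refine RB_of_RES L _ _ _ (Ind_comap _ (fun x hx => Subtype.ext hx) _ (Ind_free _)) ?_
    refine ⟨fun i => k (i + 1), fun i => d (i + 1), fun i => φ (i + 1),
      ((c 0).toLinearMap ∘ₗ φ 0).codRestrict (LinearMap.ker e) hmem, fun i hi => h1 _ (by omega),
      fun i => h2 (i + 1), ?_, ?_, ?_, fun i => h6 (i + 1), fun i a => ?_⟩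
    · intro a
      exact h2 0 a
    · rintro ⟨x, hx⟩
      have hx' : (c 0).symm x ∈ LinearMap.range (φ 0) := by rw [h5]; exact hx
      obtain ⟨y, hy⟩ := hx'
      refine ⟨y, Subtype.ext ?_⟩
      change (c 0) (φ 0 y) = x
      rw [hy, LinearEquiv.apply_symm_apply]
    · rw [h6 0, LinearMap.ker_codRestrict, LinearEquiv.ker_comp]
    · have := h7 (i + 1) a
      change d (i + 1) a ≤ _
      omega

theorem RES_of_RB : ∀ (L : ℕ) (M : Type (max u₁ u₂)) [AddCommGroup M] [Module (MvPolynomial σ K) M]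
    (𝓜 : GM (homogeneousSubmodule σ K) M) (r : ℕ), RB (homogeneousSubmodule σ K) L M 𝓜 r → RES M 𝓜 L r
  | 0, M, _, _, 𝓜, r, h => by
    have h : Subsingleton M := h
    refine ⟨fun _ => 0, fun _ _ => 0, fun _ => 0, 0, fun _ _ => rfl, fun i b => b.elim0,
      fun a => a.elim0, fun x => ⟨0, Subsingleton.elim _ _⟩, ?_, ?_, fun i a => a.elim0⟩
    · exact Subsingleton.elim _ _
    · intro i; exact Subsingleton.elim _ _
  | L + 1, M, _, _, 𝓜, r, h => by
    classical
    obtain ⟨ι, hι, d₀, e, hd, eh, es, hr⟩ := h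
    obtain ⟨k, d, φ, ε, h1, h2, h3, h4, h5, h6, h7⟩ := RES_of_RB L _ _ _ hr
    let q := Fintype.equivFin ι
    let c : (Fin (Fintype.card ι) →₀ (MvPolynomial σ K)) ≃ₗ[(MvPolynomial σ K)] (ι → (MvPolynomial σ K)) :=
      (Finsupp.domLCongr q.symm).trans (Finsupp.linearEquivFunOnFinite (MvPolynomial σ K) (MvPolynomial σ K) ι)
    have hc : ∀ a, c (Finsupp.single a 1) = Pi.single (q.symm a) 1 := by
      intro a
      simp only [c, LinearEquiv.trans_apply, Finsupp.domLCongr_single]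
      exact Finsupp.linearEquivFunOnFinite_single _ _ _ _ _
    have hcs : ∀ x a, c.symm x a = x (q.symm a) := by
      intro x a
      obtain ⟨y, rfl⟩ := c.surjective x
      rw [LinearEquiv.symm_apply_apply]
      simp [c, Finsupp.domLCongr_apply, Finsupp.domCongr_apply, Finsupp.equivMapDomain_apply]
    refine ⟨fun i => Nat.rec (Fintype.card ι) (fun i _ => k i) i,
      fun i => Nat.rec (motive := fun i => Fin (Nat.rec (Fintype.card ι) (fun i _ => k i) i) → ℕ)
        (fun a => d₀ (q.symm a)) (fun i _ => d i) i,
      fun i => Nat.rec (motive := fun i =>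
        ((Fin (Nat.rec (Fintype.card ι) (fun i _ => k i) (i + 1)) →₀ (MvPolynomial σ K)) →ₗ[(MvPolynomial σ K)]
          (Fin (Nat.rec (Fintype.card ι) (fun i _ => k i) i) →₀ (MvPolynomial σ K))))
        (c.symm.toLinearMap ∘ₗ (LinearMap.ker e).subtype ∘ₗ ε) (fun i _ => φ i) i,
      e ∘ₗ c.toLinearMap, ?_, ?_, ?_, ?_, ?_, ?_, ?_⟩
    · intro i hi
      cases i with
      | zero => omega
      | succ i => exact h1 i (by omega)
    · intro i
      cases i with
      | zero =>
        intro b a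
        have := h3 b (q.symm a)
        change (c.symm (ε (Finsupp.single b 1) : ι → (MvPolynomial σ K))) a ∈ _ ∧
          (_ → (c.symm (ε (Finsupp.single b 1) : ι → (MvPolynomial σ K))) a = 0)
        rw [hcs]
        exact this
      | succ i => exact h2 i
    · intro a
      change e (c (Finsupp.single a 1)) ∈ 𝓜.gr (d₀ (q.symm a))
      rw [hc]
      exact eh (some _) _ (single_mem_freeGr d₀ _)
    · exact es.surj.comp c.surjective
    · change LinearMap.range (c.symm.toLinearMap ∘ₗ (LinearMap.ker e).subtype ∘ₗ ε) =
        LinearMap.ker (e ∘ₗ c.toLinearMap)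
      ext x
      constructor
      · rintro ⟨y, rfl⟩
        change e (c (c.symm (ε y : ι → (MvPolynomial σ K)))) = 0
        rw [LinearEquiv.apply_symm_apply]
        exact (ε y).2
      · intro hx
        obtain ⟨y, hy⟩ := h4 ⟨c x, hx⟩
        refine ⟨y, ?_⟩
        change c.symm (ε y : ι → (MvPolynomial σ K)) = x
        rw [hy, LinearEquiv.symm_apply_apply]
    · intro i
      cases i with
      | zero =>
        change LinearMap.range (φ 0) =
          LinearMap.ker (c.symm.toLinearMap ∘ₗ (LinearMap.ker e).subtype ∘ₗ ε)
        rw [h5, LinearEquiv.ker_comp, LinearMap.ker_comp_of_ker_eq_bot _ (Submodule.ker_subtype _)]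
      | succ i => exact h6 i
    · intro i
      cases i with
      | zero => intro a; simpa using hd (q.symm a)
      | succ i =>
        intro a
        have := h7 i a
        change d i a ≤ _
        omega

noncomputable def quotGr (I : Ideal (MvPolynomial σ K)) : GM (homogeneousSubmodule σ K) ((MvPolynomial σ K) ⧸ I) where
  gr n := ((homogeneousSubmodule σ K n).map (Ideal.Quotient.mkₐ K I).toLinearMap).toAddSubgroup
  smul_mem m n a x ha hx := by
    obtain ⟨p, hp, rfl⟩ := hx
    exact ⟨a * p, SetLike.mul_mem_graded (A := homogeneousSubmodule σ K) ha hp, rfl⟩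

theorem mem_quotGr (I : Ideal (MvPolynomial σ K)) (n : ℕ) (x : (MvPolynomial σ K) ⧸ I) : x ∈ (quotGr I).gr n ↔
    ∃ p ∈ homogeneousSubmodule σ K n, Ideal.Quotient.mk I p = x := Iff.rfl

theorem Ind_quot (I : Ideal (MvPolynomial σ K)) (hI : ∀ p ∈ I, ∀ n, homogeneousComponent n p ∈ I) :
    Ind (quotGr I) := by
  intro N y hy hs m hm
  choose p hp hpy using hy
  have h1 : ∑ k ∈ Finset.range N, p k ∈ I := by
    rw [← Ideal.Quotient.eq_zero_iff_mem, map_sum, ← hs]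
    exact Finset.sum_congr rfl fun k _ => hpy k
  have h2 := hI _ h1 m
  rw [map_sum, Finset.sum_eq_single m] at h2
  · rw [homogeneousComponent_of_mem (hp m), if_pos rfl] at h2
    rw [← hpy m]; exact Ideal.Quotient.eq_zero_iff_mem.2 h2
  · intro b _ hb
    rw [homogeneousComponent_of_mem (hp b), if_neg (by omega)]
  · intro h; exact absurd (Finset.mem_range.2 hm) h

theorem regBound_iff (I : Ideal (MvPolynomial σ K)) (hI : ∀ p ∈ I, ∀ n, homogeneousComponent n p ∈ I) (r : ℕ) :
    regBound K I r ↔ ERB (homogeneousSubmodule σ K) ((MvPolynomial σ K) ⧸ I) (quotGr I) r := by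
  constructor
  · rintro ⟨L, h⟩
    exact ⟨L, RB_of_RES L _ _ r (Ind_quot I hI) h⟩
  · rintro ⟨L, h⟩
    exact ⟨L, RES_of_RB L _ _ r h⟩

end Convert

section Mono

universe u₁ u₂

variable {K : Type u₁} [Field K] {σ : Type u₂}

def MI (I : Ideal (MvPolynomial σ K)) (U : (σ →₀ ℕ) → Prop) : Prop :=
  ∀ p, p ∈ I ↔ ∀ m, coeff m p ≠ 0 → U m

theorem MI.homog {I : Ideal (MvPolynomial σ K)} {U : (σ →₀ ℕ) → Prop} (h : MI I U) :
    ∀ p ∈ I, ∀ n, homogeneousComponent n p ∈ I := by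
  intro p hp n
  rw [h] at hp ⊢
  intro m hm
  rw [coeff_homogeneousComponent] at hm
  split_ifs at hm
  · exact hp m hm
  · exact absurd rfl hm

theorem exists_MI (U : (σ →₀ ℕ) → Prop) (hU : ∀ m m', U m → U (m' + m)) :
    ∃ I : Ideal (MvPolynomial σ K), MI I U := by
  classical
  refine ⟨{ carrier := {p | ∀ m, coeff m p ≠ 0 → U m}, zero_mem' := ?_, add_mem' := ?_, smul_mem' := ?_ }, fun p => Iff.rfl⟩
  · intro p q hp hq m hm
    rw [coeff_add] at hm
    by_cases h : coeff m p = 0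
    · exact hq m (by simpa [h] using hm)
    · exact hp m h
  · intro m hm; simp at hm
  · intro c p hp m hm
    rw [smul_eq_mul, MvPolynomial.coeff_mul] at hm
    obtain ⟨x, hx, hne⟩ := Finset.exists_ne_zero_of_sum_ne_zero hm
    rw [Finset.HasAntidiagonal.mem_antidiagonal] at hx
    rw [← hx]
    exact hU _ _ (hp _ (right_ne_zero_of_mul hne))

theorem MI_edge (G : SimpleGraph σ) :
    MI (edgeIdeal K G) (fun m => ∃ a b, G.Adj a b ∧ m a ≠ 0 ∧ m b ≠ 0) := by
  classical
  intro p
  have h1 : edgeIdeal K G = Ideal.span ((fun s => MvPolynomial.monomial s (1 : K)) ''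
      {m : σ →₀ ℕ | ∃ a b, G.Adj a b ∧ m = Finsupp.single a 1 + Finsupp.single b 1}) := by
    unfold edgeIdeal
    congr 1
    ext q
    constructor
    · rintro ⟨a, b, h, rfl⟩
      exact ⟨_, ⟨a, b, h, rfl⟩, by simp [MvPolynomial.X, MvPolynomial.monomial_mul]⟩
    · rintro ⟨_, ⟨a, b, h, rfl⟩, rfl⟩
      exact ⟨a, b, h, by simp [MvPolynomial.X, MvPolynomial.monomial_mul]⟩
  rw [h1, mem_ideal_span_monomial_image]
  refine forall_congr' fun m => ?_
  rw [mem_support_iff]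
  refine imp_congr Iff.rfl ?_
  constructor
  · rintro ⟨_, ⟨a, b, h, rfl⟩, hle⟩
    refine ⟨a, b, h, ?_, ?_⟩
    · have := hle a; simp at this; omega
    · have := hle b; simp at this; omega
  · rintro ⟨a, b, h, ha, hb⟩
    refine ⟨_, ⟨a, b, h, rfl⟩, ?_⟩
    intro c
    have hab := h.ne
    simp only [Finsupp.add_apply, Finsupp.single_apply]
    by_cases h1 : a = c
    · subst h1; simp [hab.symm]; omega
    · by_cases h2 : b = c
      · subst h2; simp [h1]; omega
      · simp [h1, h2]

theorem mul_le {I J : Ideal (MvPolynomial σ K)} {U : (σ →₀ ℕ) → Prop} {k : σ}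
    (hI : MI I U) (hJ : MI J (fun m => U (Finsupp.single k 1 + m))) (p : MvPolynomial σ K) :
    X k * p ∈ I ↔ p ∈ J := by
  classical
  rw [hI, hJ]
  constructor
  · intro h m hm
    exact h _ (by rwa [coeff_X_mul])
  · intro h m hm
    rw [coeff_X_mul'] at hm
    split_ifs at hm with hk
    · have := h _ hm
      beta_reduce at this
      rwa [add_tsub_cancel_of_le] at this
      rw [Finsupp.single_le_iff]
      have := Finsupp.mem_support_iff.1 hk
      omega
    · exact absurd rfl hm

noncomputable def mulQ {I J : Ideal (MvPolynomial σ K)} {U : (σ →₀ ℕ) → Prop} {k : σ}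
    (hI : MI I U) (hJ : MI J (fun m => U (Finsupp.single k 1 + m))) :
    (MvPolynomial σ K ⧸ J) →ₗ[MvPolynomial σ K] (MvPolynomial σ K ⧸ I) :=
  Submodule.mapQ J I (LinearMap.mulLeft (MvPolynomial σ K) (X k : MvPolynomial σ K)) (fun p hp => (mul_le hI hJ p).2 hp)

theorem mulQ_mk {I J : Ideal (MvPolynomial σ K)} {U : (σ →₀ ℕ) → Prop} {k : σ}
    (hI : MI I U) (hJ : MI J (fun m => U (Finsupp.single k 1 + m))) (p : MvPolynomial σ K) :
    mulQ hI hJ (Ideal.Quotient.mk J p) = Ideal.Quotient.mk I (X k * p) := rfl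

theorem SES_mul {I J : Ideal (MvPolynomial σ K)} {U : (σ →₀ ℕ) → Prop} {k : σ}
    (hI : MI I U) (hJ : MI J (fun m => U (Finsupp.single k 1 + m)))
    {P : Type (max u₁ u₂)} [AddCommGroup P] [Module (MvPolynomial σ K) P]
    (𝓟 : GM (homogeneousSubmodule σ K) P)
    (g : (MvPolynomial σ K ⧸ I) →ₗ[MvPolynomial σ K] P)
    (gh : GH g (quotGr I) 𝓟) (gs : GS g (quotGr I) 𝓟)
    (hg : ∀ p, g (Ideal.Quotient.mk I p) = 0 ↔ ∀ m, coeff m p ≠ 0 → U m ∨ m k ≠ 0) :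
    SES (mulQ hI hJ) g (quotGr J).shift (quotGr I) 𝓟 := by
  classical
  have key : ∀ (p q : MvPolynomial σ K) (N : ℕ), q ∈ homogeneousSubmodule σ K N →
      Ideal.Quotient.mk I q = Ideal.Quotient.mk I (X k * p) →
      ∀ m, coeff m p ≠ 0 → m.degree + 1 ≠ N → U (Finsupp.single k 1 + m) := by
    intro p q N hq h m hm hd
    rw [Ideal.Quotient.eq, hI] at h
    apply h
    rw [coeff_sub, coeff_X_mul]
    have : coeff (Finsupp.single k 1 + m) q = 0 := by
      rw [mem_homogeneousSubmodule] at hq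
      refine hq.coeff_eq_zero ?_
      rw [map_add, Finsupp.degree_single]
      omega
    rw [this, zero_sub]
    exact neg_ne_zero.2 hm
  refine ⟨?_, ?_, gh, gs, ?_⟩
  · intro x hx
    obtain ⟨p, rfl⟩ := Ideal.Quotient.mk_surjective x
    rw [mulQ_mk, Ideal.Quotient.eq_zero_iff_mem] at hx
    exact Ideal.Quotient.eq_zero_iff_mem.2 ((mul_le hI hJ p).1 hx)
  · intro o x
    obtain ⟨p, rfl⟩ := Ideal.Quotient.mk_surjective x
    rcases o with - | - | n
    · exact ⟨fun _ => trivial, fun _ => trivial⟩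
    · constructor
      · intro h
        have h : Ideal.Quotient.mk J p = 0 := h
        rw [h, map_zero]; exact zero_mem _
      · intro h
        obtain ⟨q, hq, h⟩ := (mem_quotGr I 0 _).1 h
        rw [mulQ_mk] at h
        change Ideal.Quotient.mk J p = 0
        rw [Ideal.Quotient.eq_zero_iff_mem, hJ]
        intro m hm
        exact key p q 0 hq h m hm (by omega)
    · constructor
      · intro h
        obtain ⟨q, hq, h⟩ := (mem_quotGr J n _).1 h
        refine (mem_quotGr I (n+1) _).2 ⟨X k * q, ?_, ?_⟩
        · rw [mem_homogeneousSubmodule] at hq ⊢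
          rw [add_comm]
          exact (isHomogeneous_X K k).mul hq
        · rw [← h, mulQ_mk]
      · intro h
        obtain ⟨q, hq, h⟩ := (mem_quotGr I (n+1) _).1 h
        rw [mulQ_mk] at h
        refine (mem_quotGr J n _).2 ⟨homogeneousComponent n p, homogeneousComponent_mem _ _, ?_⟩
        rw [eq_comm, Ideal.Quotient.eq, hJ]
        intro m hm
        rw [coeff_sub, coeff_homogeneousComponent] at hm
        split_ifs at hm with hd
        · simp at hm
        · rw [sub_zero] at hm
          exact key p q _ hq h m hm (by omega)
  · intro y
    obtain ⟨p, rfl⟩ := Ideal.Quotient.mk_surjective y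
    rw [hg]
    constructor
    · intro h
      refine ⟨Ideal.Quotient.mk J (divMonomial p (Finsupp.single k 1)), ?_⟩
      rw [mulQ_mk, eq_comm, Ideal.Quotient.eq, hI]
      have h2 := divMonomial_add_modMonomial_single p k
      have h3 : p - X k * (divMonomial p (Finsupp.single k 1)) = modMonomial p (Finsupp.single k 1) := by
        rw [sub_eq_iff_eq_add, add_comm]; exact h2.symm
      rw [h3]
      intro m hm
      by_cases hle : Finsupp.single k 1 ≤ m
      · rw [coeff_modMonomial_of_le _ hle] at hm; exact absurd rfl hm
      · rw [coeff_modMonomial_of_not_le _ hle] at hm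
        rcases h m hm with h | h
        · exact h
        · exact absurd (Finsupp.single_le_iff.2 (by omega)) hle
    · rintro ⟨x, hx⟩
      obtain ⟨q, rfl⟩ := Ideal.Quotient.mk_surjective x
      rw [mulQ_mk, eq_comm, Ideal.Quotient.eq, hI] at hx
      intro m hm
      by_cases hk : m k = 0
      · left
        apply hx
        rw [coeff_sub, coeff_X_mul', if_neg (by simpa using hk), sub_zero]
        exact hm
      · exact Or.inr hk

theorem SES_var {I J L : Ideal (MvPolynomial σ K)} {U : (σ →₀ ℕ) → Prop} {k : σ}
    (hI : MI I U) (hJ : MI J (fun m => U (Finsupp.single k 1 + m)))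
    (hL : MI L (fun m => U m ∨ m k ≠ 0)) :
    ∃ f g, SES (A := MvPolynomial σ K) f g (quotGr J).shift (quotGr I) (quotGr L) := by
  have hle : I ≤ L := fun p hp => (hL p).2 fun m hm => Or.inl ((hI p).1 hp m hm)
  refine ⟨_, Submodule.mapQ I L LinearMap.id hle, SES_mul hI hJ _ _ ?_ ?_ ?_⟩
  · refine GH.mk fun n x hx => ?_
    obtain ⟨q, hq, rfl⟩ := (mem_quotGr _ _ _).1 hx
    exact (mem_quotGr _ _ _).2 ⟨q, hq, rfl⟩
  · intro o y hy
    cases o with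
    | none =>
      obtain ⟨p, rfl⟩ := Ideal.Quotient.mk_surjective y
      exact ⟨Ideal.Quotient.mk I p, trivial, rfl⟩
    | some n =>
      obtain ⟨q, hq, rfl⟩ := (mem_quotGr _ _ _).1 hy
      exact ⟨Ideal.Quotient.mk I q, (mem_quotGr _ _ _).2 ⟨q, hq, rfl⟩, rfl⟩
  · intro p
    change Ideal.Quotient.mk L p = 0 ↔ _
    rw [Ideal.Quotient.eq_zero_iff_mem, hL]

theorem ERB_bot {I : Ideal (MvPolynomial σ K)} (hI : MI I (fun _ => False)) :
    ERB (homogeneousSubmodule σ K) (MvPolynomial σ K ⧸ I) (quotGr I) 0 := by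
  have h0 : ∀ p ∈ I, p = 0 := by
    intro p hp
    ext m
    by_contra h
    exact (hI p).1 hp m h
  refine ERB.step (ι := Unit) (fun _ => 0) ((Submodule.mkQ I) ∘ₗ LinearMap.proj ()) (fun _ => le_rfl) ?_ ?_ ?_
  · refine GH.mk fun n x hx => ?_
    exact (mem_quotGr _ _ _).2 ⟨x (), (hx ()).1, rfl⟩
  · intro o y hy
    cases o with
    | none =>
      obtain ⟨p, rfl⟩ := Ideal.Quotient.mk_surjective y
      exact ⟨fun _ => p, trivial, rfl⟩
    | some n =>
      obtain ⟨q, hq, rfl⟩ := (mem_quotGr _ _ _).1 hy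
      exact ⟨fun _ => q, fun _ => ⟨hq, fun h => absurd h (Nat.not_lt_zero _)⟩, rfl⟩
  · refine ⟨0, ?_⟩
    refine ⟨fun x y => ?_⟩
    have : ∀ z : LinearMap.ker ((Submodule.mkQ I) ∘ₗ (LinearMap.proj () : (Unit → MvPolynomial σ K) →ₗ[MvPolynomial σ K] _)), z = 0 := by
      rintro ⟨z, hz⟩
      have := h0 _ (Ideal.Quotient.eq_zero_iff_mem.1 hz)
      ext1; funext a; exact this
    rw [this x, this y]

theorem ERB_vars [DecidableEq σ] (T : Finset σ) : ∀ {I : Ideal (MvPolynomial σ K)} (_ : MI I (fun m => ∃ k ∈ T, m k ≠ 0)),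
    ERB (homogeneousSubmodule σ K) (MvPolynomial σ K ⧸ I) (quotGr I) 0 := by
  induction T using Finset.induction_on with
  | empty => intro I hI; exact ERB_bot (by simpa using hI)
  | insert k T hk ih =>
    intro L hL
    obtain ⟨I, hI⟩ := exists_MI (K := K) (fun m : σ →₀ ℕ => ∃ k ∈ T, m k ≠ 0)
      (by rintro m m' ⟨k, hk, h⟩; exact ⟨k, hk, by simp; omega⟩)
    have e1 : (fun m : σ →₀ ℕ => ∃ l ∈ T, (Finsupp.single k 1 + m : σ →₀ ℕ) l ≠ 0) = fun m => ∃ k ∈ T, m k ≠ 0 := by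
      funext m
      refine propext (exists_congr fun l => and_congr_right fun hl => ?_)
      have : k ≠ l := by rintro rfl; exact hk hl
      simp [Finsupp.single_apply, this]
    have e2 : (fun m : σ →₀ ℕ => ∃ l ∈ insert k T, m l ≠ 0) = fun m => (∃ k ∈ T, m k ≠ 0) ∨ m k ≠ 0 := by
      funext m
      simp [or_comm]
    obtain ⟨f, g, S⟩ := SES_var (k := k) (J := I) (L := L) hI (by rw [e1]; exact hI) (by rw [← e2]; exact hL)
    exact ERB.right S (ih hI).shift (ih hI)

theorem ERB_colon [DecidableEq σ] (T : Finset σ) (i j : σ) (hij : i ≠ j) (hi : i ∉ T) {I : Ideal (MvPolynomial σ K)}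
    (hI : MI I (fun m => (∃ k ∈ T, m k ≠ 0) ∨ (m i ≠ 0 ∧ m j ≠ 0))) :
    ERB (homogeneousSubmodule σ K) (MvPolynomial σ K ⧸ I) (quotGr I) 1 := by
  obtain ⟨J, hJ⟩ := exists_MI (K := K) (fun m : σ →₀ ℕ => ∃ k ∈ insert j T, m k ≠ 0)
      (by rintro m m' ⟨k, hk, h⟩; exact ⟨k, hk, by simp; omega⟩)
  obtain ⟨L, hL⟩ := exists_MI (K := K) (fun m : σ →₀ ℕ => ∃ k ∈ insert i T, m k ≠ 0)
      (by rintro m m' ⟨k, hk, h⟩; exact ⟨k, hk, by simp; omega⟩)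
  have e1 : (fun m : σ →₀ ℕ => (∃ l ∈ T, (Finsupp.single i 1 + m : σ →₀ ℕ) l ≠ 0) ∨
      ((Finsupp.single i 1 + m : σ →₀ ℕ) i ≠ 0 ∧ (Finsupp.single i 1 + m : σ →₀ ℕ) j ≠ 0)) = fun m => ∃ k ∈ insert j T, m k ≠ 0 := by
    funext m
    refine propext ?_
    have h1 : (∃ l ∈ T, (Finsupp.single i 1 + m : σ →₀ ℕ) l ≠ 0) ↔ ∃ l ∈ T, m l ≠ 0 := by
      refine (exists_congr fun l => and_congr_right fun hl => ?_)
      have : i ≠ l := by rintro rfl; exact hi hl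
      simp [Finsupp.single_apply, this]
    rw [h1]
    simp [Finsupp.single_apply, hij, or_comm]
  have e2 : (fun m : σ →₀ ℕ => ((∃ l ∈ T, m l ≠ 0) ∨ (m i ≠ 0 ∧ m j ≠ 0)) ∨ m i ≠ 0)
      = fun m => ∃ k ∈ insert i T, m k ≠ 0 := by
    funext m
    simp only [Finset.mem_insert, exists_eq_or_imp, eq_iff_iff]
    exact ⟨fun h => h.elim (fun h => h.elim Or.inr fun h => Or.inl h.1) Or.inl,
      fun h => h.elim Or.inr fun h => Or.inl (Or.inl h)⟩
  obtain ⟨f, g, S⟩ := SES_var (k := i) (J := J) (L := L) hI (by rw [e1]; exact hJ) (by rw [e2]; exact hL)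
  exact ERB.mid S (ERB_vars _ hJ).shift ((ERB_vars _ hL).mono (by omega))

end Mono

section Final

universe u₁ u₂

variable {K : Type u₁} [Field K] {V : Type u₂} [Fintype V]

theorem homog_iff {σ : Type*} (p : MvPolynomial σ K) (n : ℕ) :
    p ∈ homogeneousSubmodule σ K n ↔ ∀ m, coeff m p ≠ 0 → m.degree = n := by
  rw [mem_homogeneousSubmodule]
  constructor
  · intro h m hm
    by_contra hd
    exact hm (h.coeff_eq_zero hd)
  · intro h m hm
    have := h m hm
    rwa [Finsupp.degree_eq_weight_one] at this

noncomputable def theta (K : Type u₁) [Field K] (V : Type u₂) :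
    MvPolynomial (Option V) K →+* MvPolynomial V K :=
  (Polynomial.constantCoeff).comp (optionEquivLeft K V).toRingEquiv.toRingHom

theorem theta_coeff (p : MvPolynomial (Option V) K) (d : V →₀ ℕ) :
    coeff d (theta K V p) = coeff (d.optionElim 0) p :=
  optionEquivLeft_coeff_coeff K p 0 d

theorem degree_oe (d : V →₀ ℕ) : (d.optionElim 0).degree = d.degree := by
  rw [Finsupp.degree_eq_sum, Finsupp.degree_eq_sum, Fintype.sum_option]
  simp [Finsupp.optionElim_apply_none, Finsupp.optionElim_apply_some]

theorem theta_rename (q : MvPolynomial V K) : theta K V (rename some q) = q := by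
  induction q using MvPolynomial.induction_on with
  | C a => simp [theta]
  | add p q hp hq => rw [map_add, map_add, hp, hq]
  | mul_X p n hp => rw [map_mul, map_mul, hp]; simp [theta]

noncomputable def thetaAlg (K : Type u₁) [Field K] (V : Type u₂) :
    Algebra (MvPolynomial (Option V) K) (MvPolynomial V K) := (theta K V).toAlgebra

attribute [local instance] thetaAlg

theorem algMap (p : MvPolynomial (Option V) K) :
    algebraMap (MvPolynomial (Option V) K) (MvPolynomial V K) p = theta K V p := rfl

theorem CR_theta : CR (homogeneousSubmodule (Option V) K) (homogeneousSubmodule V K)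
    (MvPolynomial.X none : MvPolynomial (Option V) K) where
  surj x := ⟨rename some x, theta_rename x⟩
  surjg n x hx := ⟨rename some x, by
    rw [mem_homogeneousSubmodule] at hx ⊢
    exact hx.rename_isHomogeneous, theta_rename x⟩
  map_mem n y hy := by
    rw [homog_iff] at hy ⊢
    intro m hm
    rw [algMap, theta_coeff] at hm
    rw [← degree_oe]; exact hy _ hm
  ker y hy := by
    classical
    refine (X_dvd_iff_modMonomial_eq_zero).2 ?_
    ext m
    rw [coeff_zero]
    by_cases hle : Finsupp.single none 1 ≤ m
    · rw [coeff_modMonomial_of_le _ hle]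
    · rw [coeff_modMonomial_of_not_le _ hle]
      have h0 : m none = 0 := by
        by_contra h
        exact hle (Finsupp.single_le_iff.2 (by omega))
      have h1 : m.some.optionElim 0 = m := by
        conv_rhs => rw [← Finsupp.optionElim_some m, h0]
      rw [← h1, ← theta_coeff, ← algMap, hy, coeff_zero]
  v_ker := by
    rw [algMap]; simp [theta]
  v_mem := by
    rw [mem_homogeneousSubmodule]; exact isHomogeneous_X K none
  reg0 y hy := (mul_eq_zero.1 hy).resolve_left (MvPolynomial.X_ne_zero _)
  regs n y hy := by
    rw [homog_iff] at hy ⊢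
    intro m hm
    have := hy (Finsupp.single none 1 + m) (by rwa [coeff_X_mul])
    rw [map_add, Finsupp.degree_single] at this
    omega
  regz y hy := by
    rw [homog_iff] at hy
    ext m
    rw [coeff_zero]
    by_contra hm
    have := hy (Finsupp.single none 1 + m) (by rwa [coeff_X_mul])
    rw [map_add, Finsupp.degree_single] at this
    omega

theorem adj_ss (G : SimpleGraph V) (i j : V) (S : Set V) (a b : V) :
    (eSusp G i j S).Adj (some a) (some b) ↔ G.Adj a b := by
  simp only [eSusp, SimpleGraph.fromRel_adj]
  constructor
  · rintro ⟨-, (⟨x, y, hx, hy, h⟩ | ⟨h, -⟩) | (⟨x, y, hx, hy, h⟩ | ⟨h, -⟩)⟩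
    · cases hx; cases hy; exact h
    · cases h
    · cases hx; cases hy; exact h.symm
    · cases h
  · intro h
    exact ⟨fun e => h.ne (Option.some.inj e), Or.inl (Or.inl ⟨a, b, rfl, rfl, h⟩)⟩

theorem adj_ns (G : SimpleGraph V) (i j : V) (S : Set V) (b : V) :
    (eSusp G i j S).Adj none (some b) ↔ (b ∉ S ∧ b ≠ i ∧ b ≠ j) := by
  simp only [eSusp, SimpleGraph.fromRel_adj]
  constructor
  · rintro ⟨-, (⟨x, y, hx, hy, h⟩ | ⟨h, y, hy, h'⟩) | (⟨x, y, hx, hy, h⟩ | ⟨h, -⟩)⟩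
    · cases hx
    · cases hy; exact h'
    · cases hy
    · cases h
  · intro h
    exact ⟨by simp, Or.inl (Or.inr ⟨trivial, b, rfl, h⟩)⟩

def UE {σ : Type*} (G : SimpleGraph σ) (m : σ →₀ ℕ) : Prop := ∃ a b, G.Adj a b ∧ m a ≠ 0 ∧ m b ≠ 0

theorem UE_susp (G : SimpleGraph V) (i j : V) (S : Set V) (m : Option V →₀ ℕ) :
    UE (eSusp G i j S) m ↔ (∃ a b, G.Adj a b ∧ m (some a) ≠ 0 ∧ m (some b) ≠ 0) ∨
      (m none ≠ 0 ∧ ∃ b, (b ∉ S ∧ b ≠ i ∧ b ≠ j) ∧ m (some b) ≠ 0) := by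
  constructor
  · rintro ⟨a | a, b | b, h, ha, hb⟩
    · exact absurd rfl h.ne
    · exact Or.inr ⟨ha, b, (adj_ns G i j S b).1 h, hb⟩
    · exact Or.inr ⟨hb, a, (adj_ns G i j S a).1 h.symm, ha⟩
    · exact Or.inl ⟨a, b, (adj_ss G i j S a b).1 h, ha, hb⟩
  · rintro (⟨a, b, h, ha, hb⟩ | ⟨h, b, hb, hb'⟩)
    · exact ⟨_, _, (adj_ss G i j S a b).2 h, ha, hb⟩
    · exact ⟨_, _, (adj_ns G i j S b).2 hb, h, hb'⟩

theorem UE_colon (G : SimpleGraph V) (i j : V) (hij : G.Adj i j) (S : Set V)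
    (hS : ∀ x ∈ S, ∀ y ∈ S, ¬ G.Adj x y)
    (hSij : ∀ x ∈ S, ¬ G.Adj x i ∧ ¬ G.Adj x j) (m : Option V →₀ ℕ) :
    UE (eSusp G i j S) (Finsupp.single none 1 + m) ↔
      (∃ b, (b ∉ S ∧ b ≠ i ∧ b ≠ j) ∧ m (some b) ≠ 0) ∨ (m (some i) ≠ 0 ∧ m (some j) ≠ 0) := by
  rw [UE_susp]
  have e : ∀ a, (Finsupp.single none 1 + m : Option V →₀ ℕ) (some a) = m (some a) := by
    intro a; simp
  have e' : (Finsupp.single none 1 + m : Option V →₀ ℕ) none ≠ 0 := by simp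
  simp only [e]
  constructor
  · rintro (⟨a, b, h, ha, hb⟩ | ⟨-, h⟩)
    · by_cases hA : a ∉ S ∧ a ≠ i ∧ a ≠ j
      · exact Or.inl ⟨a, hA, ha⟩
      by_cases hB : b ∉ S ∧ b ≠ i ∧ b ≠ j
      · exact Or.inl ⟨b, hB, hb⟩
      right
      have hA' : a ∈ S ∨ a = i ∨ a = j := by
        by_contra hc; push Not at hc; exact hA hc
      have hB' : b ∈ S ∨ b = i ∨ b = j := by
        by_contra hc; push Not at hc; exact hB hc
      clear hA hB
      rcases hA' with hA | rfl | rfl <;> rcases hB' with hB | rfl | rfl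
      · exact absurd h (hS _ hA _ hB)
      · exact absurd h (hSij _ hA).1
      · exact absurd h (hSij _ hA).2
      · exact absurd h.symm (hSij _ hB).1
      · exact absurd rfl h.ne
      · exact ⟨ha, hb⟩
      · exact absurd h.symm (hSij _ hB).2
      · exact ⟨hb, ha⟩
      · exact absurd rfl h.ne
    · exact Or.inl h
  · rintro (h | ⟨h1, h2⟩)
    · exact Or.inr ⟨e', h⟩
    · exact Or.inl ⟨i, j, hij, h1, h2⟩

theorem theta_mem (G : SimpleGraph V) (i j : V) (S : Set V) (p : MvPolynomial (Option V) K) :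
    theta K V p ∈ edgeIdeal K G ↔
      ∀ m, coeff m p ≠ 0 → UE (eSusp G i j S) m ∨ m none ≠ 0 := by
  rw [MI_edge G]
  constructor
  · intro h m hm
    by_cases h0 : m none = 0
    · left
      have h1 : m.some.optionElim 0 = m := by
        conv_rhs => rw [← Finsupp.optionElim_some m, h0]
      obtain ⟨a, b, hab, ha, hb⟩ := h m.some (by rwa [theta_coeff, h1])
      exact (UE_susp G i j S m).2 (Or.inl ⟨a, b, hab, ha, hb⟩)
    · exact Or.inr h0
  · intro h m hm
    rw [theta_coeff] at hm
    rcases h _ hm with h | h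
    · rcases (UE_susp G i j S _).1 h with ⟨a, b, hab, ha, hb⟩ | ⟨h, -⟩
      · rw [Finsupp.optionElim_apply_some] at ha hb
        exact ⟨a, b, hab, ha, hb⟩
      · rw [Finsupp.optionElim_apply_none] at h; exact absurd rfl h
    · rw [Finsupp.optionElim_apply_none] at h; exact absurd rfl h

theorem exists_SES (G : SimpleGraph V) (i j : V) (S : Set V)
    {J : Ideal (MvPolynomial (Option V) K)}
    (hJ : MI J (fun m => UE (eSusp G i j S) (Finsupp.single none 1 + m))) :
    ∃ f g, SES (A := MvPolynomial (Option V) K) f g (quotGr J).shift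
      (quotGr (edgeIdeal K (eSusp G i j S))) ((quotGr (edgeIdeal K G)).restr CR_theta) := by
  have hI : MI (edgeIdeal K (eSusp G i j S)) (UE (eSusp G i j S)) := MI_edge _
  have hle : edgeIdeal K (eSusp G i j S) ≤
      LinearMap.ker (((Submodule.mkQ (edgeIdeal K G)).restrictScalars (MvPolynomial (Option V) K)) ∘ₗ
        (Algebra.linearMap (MvPolynomial (Option V) K) (MvPolynomial V K))) := by
    intro p hp
    rw [LinearMap.mem_ker]
    change Ideal.Quotient.mk (edgeIdeal K G) (theta K V p) = 0
    rw [Ideal.Quotient.eq_zero_iff_mem, theta_mem G i j S]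
    intro m hm
    exact Or.inl ((hI p).1 hp m hm)
  have hk : ∀ p, Submodule.liftQ (edgeIdeal K (eSusp G i j S)) _ hle (Ideal.Quotient.mk _ p) =
    Ideal.Quotient.mk (edgeIdeal K G) (theta K V p) := fun p => rfl
  refine ⟨_, Submodule.liftQ (edgeIdeal K (eSusp G i j S)) _ hle, SES_mul hI hJ _ _ ?_ ?_ ?_⟩
  · refine GH.mk fun n x hx => ?_
    obtain ⟨q, hq, rfl⟩ := (mem_quotGr _ _ _).1 hx
    exact (mem_quotGr _ _ _).2 ⟨theta K V q, CR_theta.map_mem n q hq, (hk q).symm⟩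
  · intro o y hy
    cases o with
    | none =>
      obtain ⟨p, rfl⟩ := Ideal.Quotient.mk_surjective y
      refine ⟨Ideal.Quotient.mk _ (rename some p), trivial, ?_⟩
      rw [hk, theta_rename]
    | some n =>
      obtain ⟨q, hq, rfl⟩ := (mem_quotGr _ _ _).1 hy
      obtain ⟨p, hp, rfl⟩ := CR_theta.surjg n q hq
      exact ⟨Ideal.Quotient.mk _ p, (mem_quotGr _ _ _).2 ⟨p, hp, rfl⟩, hk p⟩
  · intro p
    rw [hk, Ideal.Quotient.eq_zero_iff_mem, theta_mem G i j S]

theorem main_aux (G : SimpleGraph V) (hreg : 2 ≤ reg K (edgeIdeal K G))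
    (i j : V) (hij : G.Adj i j) (S : Set V)
    (hS : ∀ x ∈ S, ∀ y ∈ S, ¬ G.Adj x y)
    (hSij : ∀ x ∈ S, ¬ G.Adj x i ∧ ¬ G.Adj x j) :
    reg K (edgeIdeal K (eSusp G i j S)) = reg K (edgeIdeal K G) := by
  classical
  have hG := fun r => regBound_iff (edgeIdeal K G) (MI_edge G).homog r
  have hH := fun r => regBound_iff (edgeIdeal K (eSusp G i j S)) (MI_edge (eSusp G i j S)).homog r
  obtain ⟨J, hJ⟩ := exists_MI (K := K) (fun m => UE (eSusp G i j S) (Finsupp.single none 1 + m))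
    (by
      rintro m m' ⟨a, b, h, ha, hb⟩
      rw [Finsupp.add_apply] at ha hb
      refine ⟨a, b, h, ?_, ?_⟩ <;> rw [Finsupp.add_apply, Finsupp.add_apply] <;> omega)
  have hJ1 : ERB (homogeneousSubmodule (Option V) K) _ (quotGr J) 1 := by
    refine ERB_colon ((Finset.univ.filter fun b => b ∉ S ∧ b ≠ i ∧ b ≠ j).image some)
      (some i) (some j) (fun e => hij.ne (Option.some.inj e)) (by simp) ?_
    have e : (fun m : Option V →₀ ℕ => UE (eSusp G i j S) (Finsupp.single none 1 + m)) =
        fun m => (∃ k ∈ (Finset.univ.filter fun b => b ∉ S ∧ b ≠ i ∧ b ≠ j).image some, m k ≠ 0) ∨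
          (m (some i) ≠ 0 ∧ m (some j) ≠ 0) := by
      funext m
      rw [UE_colon G i j hij S hS hSij m]
      simp
    rw [← e]; exact hJ
  obtain ⟨f, g, E⟩ := exists_SES G i j S hJ
  have hne : {r | regBound K (edgeIdeal K G) r}.Nonempty := by
    by_contra h
    rw [Set.not_nonempty_iff_eq_empty] at h
    unfold reg at hreg
    rw [h, Nat.sInf_empty] at hreg
    omega
  have hs := (hG _).1 (Nat.sInf_mem hne)
  change ERB _ _ _ (reg K (edgeIdeal K G)) at hs
  have hs' : ERB (homogeneousSubmodule (Option V) K) _ ((quotGr (edgeIdeal K G)).restr CR_theta)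
      (reg K (edgeIdeal K G)) := by
    obtain ⟨L, hL⟩ := hs
    exact ERB_restr CR_theta L _ _ _ hL
  have hup := (hH _).2 (ERB.mid E (hJ1.shift.mono hreg) hs')
  refine le_antisymm (Nat.sInf_le hup) ?_
  have hr := (hH _).1 (Nat.sInf_mem (s := {r | regBound K (edgeIdeal K (eSusp G i j S)) r}) ⟨_, hup⟩)
  change ERB _ _ _ (reg K (edgeIdeal K (eSusp G i j S))) at hr
  set r := reg K (edgeIdeal K (eSusp G i j S))
  set s := reg K (edgeIdeal K G) with hsd
  have h1 := ERB.right E (r := max r 1) (hJ1.shift.mono (by omega)) (hr.mono (by omega))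
  have h2 := ERB_improve CR_theta (quotGr (edgeIdeal K G)) (max r 1) s (max (max r 1) (s - 1)) h1 hs
    (by omega) (by omega)
  have h3 : s ≤ max (max r 1) (s - 1) := Nat.sInf_le ((hG _).2 h2)
  omega

end Final

/-- the `{x_i,x_j}, S`-suspension preserves regularity when
`reg(R/I(G)) ≥ 2`, under the independence, non-adjacency and domination hypotheses. -/
theorem stmt_15 (K : Type*) [Field K] {V : Type*} [Fintype V] (G : SimpleGraph V)
    (hiso : ∀ v : V, ∃ w, G.Adj v w) (hreg : 2 ≤ reg K (edgeIdeal K G))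
    (i j : V) (hij : G.Adj i j) (S : Set V)
    (hS : ∀ x ∈ S, ∀ y ∈ S, ¬ G.Adj x y)
    (hSij : ∀ x ∈ S, ¬ G.Adj x i ∧ ¬ G.Adj x j)
    (hdom : ∀ x : V, x ∉ S → x ≠ i → x ≠ j →
      ∃ y, (y ∈ S ∨ y = i ∨ y = j) ∧ G.Adj x y) :
    reg K (edgeIdeal K (eSusp G i j S)) = reg K (edgeIdeal K G) := by
  exact main_aux G hreg i j hij S hS hSij
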